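/- arXiv:2502.05501 — 2 statements merged into one kernel-verified Lean document; each statement's English description precedes it below -/
import Mathlib

section
/- (i) For each fixed ξ > 0 the function s ↦ Φ(s,ξ) is non-decreasing on (0,+∞). (ii) For all real numbers 0 < a ≤ b and 0 < c ≤ d there exists M > 0 such that |Φ(s₁,ξ₁) − Φ(s₂,ξ₂)| ≤ M (|s₁ − s₂| + |ξ₁² − ξ₂²|) for all (s₁,ξ₁), (s₂,ξ₂) ∈ [a,b] × [c,d]; in particular Φ is locally Lipschitz continuous on (0,+∞) × (0,+∞). -/
open Real MeasureTheory Set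

noncomputable section

/-- The function `r ↦ r W(r)`. -/
def rW (W : ℝ → ℝ) : ℝ → ℝ := fun r => r * W r

/-- The functional `E₁(ξ,W) = ∫_I [ξ² r ρ̄ W² + r ρ̄ |D(rW)|²] dr`. -/
def E1fun (R₁ R₂ : ℝ) (ρ : ℝ → ℝ) (ξ : ℝ) (W : ℝ → ℝ) : ℝ :=
  ∫ r in R₁..R₂, (ξ ^ 2 * r * ρ r * (W r) ^ 2 + r * ρ r * (deriv (rW W) r) ^ 2)

/-- The functional `E₂(ξ,W)`. -/
def E2fun (R₁ R₂ μ α : ℝ) (ξ : ℝ) (W : ℝ → ℝ) : ℝ :=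
  (∫ r in R₁..R₂,
    (r * (2 * ξ ^ 2 + 1) * (deriv W r) ^ 2 + ((ξ ^ 2 - 1) ^ 2 / r) * (W r) ^ 2 +
      r * (deriv (deriv (rW W)) r) ^ 2)) +
  (1 - α / μ * R₁) * (deriv (rW W) R₁) ^ 2

/-- The functional `E₃(ξ,W) = −ξ² ∫_I g r W² Dρ̄ dr`. -/
def E3fun (R₁ R₂ g : ℝ) (ρ : ℝ → ℝ) (ξ : ℝ) (W : ℝ → ℝ) : ℝ :=
  -(ξ ^ 2) * ∫ r in R₁..R₂, g * r * (W r) ^ 2 * deriv ρ r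

/-- The functional `E(s,ξ,W) = μ s E₂(ξ,W) + E₃(ξ,W)`. -/
def Efun (R₁ R₂ μ α g : ℝ) (ρ : ℝ → ℝ) (s ξ : ℝ) (W : ℝ → ℝ) : ℝ :=
  μ * s * E2fun R₁ R₂ μ α ξ W + E3fun R₁ R₂ g ρ ξ W

/-- Admissible profile: `W ∈ C²`, `W(R₁) = W(R₂) = 0` and `DW(R₂) = 0`. -/
def AdmW (R₁ R₂ : ℝ) (W : ℝ → ℝ) : Prop :=
  ContDiff ℝ 2 W ∧ W R₁ = 0 ∧ W R₂ = 0 ∧ deriv W R₂ = 0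

/-- The set of values `E(s,ξ,W)/E₁(ξ,W)` over admissible, not identically zero, `W`. -/
def PhiSet (R₁ R₂ μ α g : ℝ) (ρ : ℝ → ℝ) (s ξ : ℝ) : Set ℝ :=
  {x : ℝ | ∃ W : ℝ → ℝ, AdmW R₁ R₂ W ∧ (∃ r ∈ Icc R₁ R₂, W r ≠ 0) ∧
    x = Efun R₁ R₂ μ α g ρ s ξ W / E1fun R₁ R₂ ρ ξ W}

/-- `Φ(s,ξ) = inf { E(s,ξ,W)/E₁(ξ,W) : W admissible, W ≢ 0 }`. -/
def Phi (R₁ R₂ μ α g : ℝ) (ρ : ℝ → ℝ) (s ξ : ℝ) : ℝ :=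
  sInf (PhiSet R₁ R₂ μ α g ρ s ξ)

/-- `λ_c(ξ) = sup { −E₃(ξ,W) : W admissible, μ E₂(ξ,W) = 1 }`. -/
def lamc (R₁ R₂ μ α g : ℝ) (ρ : ℝ → ℝ) (ξ : ℝ) : ℝ :=
  sSup {x : ℝ | ∃ W : ℝ → ℝ, AdmW R₁ R₂ W ∧ μ * E2fun R₁ R₂ μ α ξ W = 1 ∧
    x = -E3fun R₁ R₂ g ρ ξ W}

/-- The quotient `E/E₁` in terms of `x = ξ²` and of the integrals occurring in the functionals. -/
def quot (μ A B C D F G s x : ℝ) : ℝ :=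
  (μ * s * ((2 * x + 1) * C + (x - 1) ^ 2 * D + F) - x * G) / (x * A + B)

/-- The Lipschitz constant, for `s ∈ [a, b]` and `x ∈ [l, u]`, of the quotient along profiles at
which it is bounded by `N`. -/
def lipConst (μ K k a b l u N : ℝ) : ℝ :=
  (μ * ((N + K) / (μ * a)) +
      (μ * b * (2 * ((N + K) / (μ * a)) + (2 * u + 2) * (k / l)) + K / l + (N + K) / l)) *
    (u / l)

section Algebra

variable {μ A B C D F G K k : ℝ}

theorem neg_le_quot (hμ : 0 ≤ μ) (hA : 0 < A) (hB : 0 ≤ B) (hC : 0 ≤ C) (hD : 0 ≤ D)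
    (hF : 0 ≤ F) (hK : 0 ≤ K) (hG : |G| ≤ K * A) {s x : ℝ} (hs : 0 ≤ s) (hx : 0 < x) :
    -K ≤ quot μ A B C D F G s x := by
  have hxA : 0 < x * A := mul_pos hx hA
  rw [quot, le_div_iff₀ (by linarith)]
  have h₁ : 0 ≤ μ * s * ((2 * x + 1) * C + (x - 1) ^ 2 * D + F) := by positivity
  have h₂ : x * G ≤ x * (K * A) := by gcongr; exact (le_abs_self G).trans hG
  have h₃ : 0 ≤ K * B := by positivity
  nlinarith

theorem quot_mono (hμ : 0 ≤ μ) (hA : 0 < A) (hB : 0 ≤ B) (hC : 0 ≤ C) (hD : 0 ≤ D)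
    (hF : 0 ≤ F) {s t x : ℝ} (hst : s ≤ t) (hx : 0 < x) :
    quot μ A B C D F G s x ≤ quot μ A B C D F G t x := by
  unfold quot
  gcongr

theorem quot_bounded_above (hμ : 0 ≤ μ) (hA : 0 < A) (hB : 0 ≤ B) (hC : 0 ≤ C) (hD : 0 ≤ D)
    (hF : 0 ≤ F) {b l u : ℝ} (hl : 0 < l) :
    ∃ N : ℝ, ∀ s ≤ b, ∀ x ∈ Icc l u, quot μ A B C D F G s x ≤ N := by
  have hc : ContinuousOn (fun x => quot μ A B C D F G b x) (Icc l u) := by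
    unfold quot
    refine ContinuousOn.div (by fun_prop) (by fun_prop) fun x hx => ?_
    have : 0 < x * A := mul_pos (hl.trans_le hx.1) hA
    linarith
  obtain ⟨N, hN⟩ := isCompact_Icc.bddAbove_image hc
  refine ⟨N, fun s hs x hx => ?_⟩
  exact (quot_mono hμ hA hB hC hD hF hs (hl.trans_le hx.1)).trans (hN ⟨x, hx, rfl⟩)

/-- A Lipschitz estimate for the quotient along profiles at which it is bounded by `N`; the
constant depends on the profile only through `N`, `K` and `k`. -/
theorem quot_sub_le (hμ : 0 < μ) (hA : 0 < A) (hB : 0 ≤ B) (hC : 0 ≤ C) (hD : 0 ≤ D)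
    (hF : 0 ≤ F) (hK : 0 ≤ K) (hG : |G| ≤ K * A) (hk : 0 ≤ k) (hDA : D ≤ k * A)
    {a b l u N s₁ s₂ x₁ x₂ : ℝ} (ha : 0 < a) (hl : 0 < l) (hN : 0 ≤ N)
    (hs₁ : s₁ ∈ Icc a b) (hs₂ : s₂ ∈ Icc a b) (hx₁ : x₁ ∈ Icc l u) (hx₂ : x₂ ∈ Icc l u)
    (hq : quot μ A B C D F G s₁ x₁ ≤ N) :
    quot μ A B C D F G s₂ x₂ - quot μ A B C D F G s₁ x₁ ≤
      lipConst μ K k a b l u N * (|s₁ - s₂| + |x₁ - x₂|) := by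
  obtain ⟨has₁, hsb₁⟩ := hs₁
  obtain ⟨has₂, hsb₂⟩ := hs₂
  obtain ⟨hlx₁, hxu₁⟩ := hx₁
  obtain ⟨hlx₂, hxu₂⟩ := hx₂
  have hx₁ : 0 < x₁ := by linarith
  have hx₂ : 0 < x₂ := by linarith
  have hs₁ : 0 < s₁ := by linarith
  have hs₂ : 0 < s₂ := by linarith
  have hu : 0 < u := by linarith
  have hb : 0 < b := by linarith
  have hq' := neg_le_quot hμ.le hA hB hC hD hF hK hG hs₁.le hx₁
  set q := quot μ A B C D F G s₁ x₁ with hqdef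
  set L := (N + K) / (μ * a) with hL
  have hL0 : 0 ≤ L := by positivity
  set e₁ := x₁ * A + B with he₁
  set e₂ := x₂ * A + B with he₂
  set T₁ := (2 * x₁ + 1) * C + (x₁ - 1) ^ 2 * D + F with hT₁
  set T₂ := (2 * x₂ + 1) * C + (x₂ - 1) ^ 2 * D + F with hT₂
  have he₁0 : 0 < e₁ := by positivity
  have he₂0 : 0 < e₂ := by positivity
  have hqe : μ * s₁ * T₁ - x₁ * G = q * e₁ := by
    rw [hqdef, quot, div_mul_cancel₀ _ he₁0.ne']
  have hAe : A ≤ e₁ / l := by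
    rw [le_div_iff₀ hl, he₁, mul_comm A]
    linarith [mul_le_mul_of_nonneg_right hlx₁ hA.le]
  have hGe : |G| ≤ K / l * e₁ := by
    calc |G| ≤ K * A := hG
      _ ≤ K * (e₁ / l) := by gcongr
      _ = K / l * e₁ := by ring
  have hDe : D ≤ k / l * e₁ := by
    calc D ≤ k * A := hDA
      _ ≤ k * (e₁ / l) := by gcongr
      _ = k / l * e₁ := by ring
  have hT₁0 : 0 ≤ T₁ := by positivity
  have hT₁e : T₁ ≤ L * e₁ := by
    have h₁ : x₁ * G ≤ K * e₁ := by
      have : x₁ * G ≤ x₁ * (K * A) := by gcongr; exact (le_abs_self G).trans hG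
      have : 0 ≤ K * B := by positivity
      rw [he₁]; linarith
    have h₂ : q * e₁ ≤ N * e₁ := by gcongr
    have h₃ : μ * a * T₁ ≤ μ * s₁ * T₁ := by gcongr
    rw [hL, div_mul_eq_mul_div, le_div_iff₀ (by positivity)]
    linarith
  have hCe : C ≤ L * e₁ := by
    refine le_trans ?_ hT₁e
    have : 0 ≤ (x₁ - 1) ^ 2 * D := by positivity
    have : 0 ≤ x₁ * C := by positivity
    rw [hT₁]; linarith
  set δ := |x₁ - x₂| with hδ
  set σ := |s₁ - s₂| with hσ
  have hδ0 : 0 ≤ δ := abs_nonneg _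
  have hσ0 : 0 ≤ σ := abs_nonneg _
  have hδ' : x₂ - x₁ ≤ δ := by rw [hδ, abs_sub_comm]; exact le_abs_self _
  have hσ' : s₂ - s₁ ≤ σ := by rw [hσ, abs_sub_comm]; exact le_abs_self _
  have hTT : T₂ - T₁ ≤ (2 * L + (2 * u + 2) * (k / l)) * e₁ * δ := by
    have h₁ : (x₂ - x₁) * (2 * C) ≤ δ * (2 * (L * e₁)) := by gcongr
    have h₂ : (x₂ - x₁) * (x₁ + x₂ - 2) * D ≤ δ * (2 * u + 2) * (k / l * e₁) := by
      have : (x₂ - x₁) * (x₁ + x₂ - 2) ≤ δ * (2 * u + 2) := by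
        refine (le_abs_self _).trans ?_
        rw [abs_mul, abs_sub_comm x₂ x₁]
        gcongr
        rw [abs_le]; constructor <;> linarith
      gcongr
    calc T₂ - T₁ = (x₂ - x₁) * (2 * C) + (x₂ - x₁) * (x₁ + x₂ - 2) * D := by
          rw [hT₁, hT₂]; ring
      _ ≤ _ := by linarith
  have hGG : (x₁ - x₂) * G ≤ δ * (K / l * e₁) := by
    refine (le_abs_self _).trans ?_
    rw [abs_mul]
    gcongr
  have hqq : q * (x₁ - x₂) * A ≤ (N + K) * δ * (e₁ / l) := by
    have : q * (x₁ - x₂) ≤ (N + K) * δ := by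
      refine (le_abs_self _).trans ?_
      rw [abs_mul]
      gcongr
      rw [abs_le]; constructor <;> linarith
    gcongr
  set P := μ * b * (2 * L + (2 * u + 2) * (k / l)) + K / l + (N + K) / l with hP
  have hP0 : 0 ≤ P := by positivity
  have hnum : (μ * s₂ * T₂ - x₂ * G) - q * e₂ ≤ (μ * L * σ + P * δ) * e₁ := by
    have h₁ : μ * s₂ * (T₂ - T₁) ≤ μ * b * ((2 * L + (2 * u + 2) * (k / l)) * e₁ * δ) := by
      have : 0 ≤ (2 * L + (2 * u + 2) * (k / l)) * e₁ * δ := by positivity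
      calc _ ≤ μ * s₂ * ((2 * L + (2 * u + 2) * (k / l)) * e₁ * δ) := by gcongr
        _ ≤ _ := by gcongr
    have h₂ : μ * (s₂ - s₁) * T₁ ≤ μ * σ * (L * e₁) := by gcongr
    calc (μ * s₂ * T₂ - x₂ * G) - q * e₂
        = μ * s₂ * (T₂ - T₁) + μ * (s₂ - s₁) * T₁ + (x₁ - x₂) * G + q * (x₁ - x₂) * A := by
          rw [he₂]; rw [he₁] at hqe; linear_combination hqe
      _ ≤ μ * b * ((2 * L + (2 * u + 2) * (k / l)) * e₁ * δ) + μ * σ * (L * e₁) +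
            δ * (K / l * e₁) + (N + K) * δ * (e₁ / l) := by gcongr
      _ = _ := by rw [hP]; ring
  have hee : e₁ ≤ u / l * e₂ := by
    have h₁ : x₁ * A ≤ u / l * (x₂ * A) := by
      rw [div_mul_eq_mul_div, le_div_iff₀ hl]
      have : x₁ * l ≤ u * x₂ := by gcongr
      linarith [mul_le_mul_of_nonneg_right this hA.le]
    have h₂ : B ≤ u / l * B := le_mul_of_one_le_left hB ((one_le_div hl).2 (by linarith))
    rw [he₁, he₂]; linarith
  have hsub : quot μ A B C D F G s₂ x₂ - q = ((μ * s₂ * T₂ - x₂ * G) - q * e₂) / e₂ := by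
    rw [sub_div _ (q * e₂), mul_div_cancel_right₀ _ he₂0.ne', quot]
  rw [hsub, div_le_iff₀ he₂0]
  calc _ ≤ (μ * L * σ + P * δ) * e₁ := hnum
    _ ≤ ((μ * L + P) * (σ + δ)) * (u / l * e₂) := by
        gcongr
        have : 0 ≤ μ * L * δ := by positivity
        have : 0 ≤ P * σ := by positivity
        linarith
    _ = _ := by rw [lipConst, hP, hL]; ring

end Algebra

section Infimum

variable {ι : Type*} {μ K k : ℝ} {A B C D F G : ι → ℝ}

theorem bddBelow_range_quot (hμ : 0 < μ) (hA : ∀ i, 0 < A i) (hB : ∀ i, 0 ≤ B i)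
    (hC : ∀ i, 0 ≤ C i) (hD : ∀ i, 0 ≤ D i) (hF : ∀ i, 0 ≤ F i) (hK : 0 ≤ K)
    (hG : ∀ i, |G i| ≤ K * A i) {s x : ℝ} (hs : 0 < s) (hx : 0 < x) :
    BddBelow (range fun i => quot μ (A i) (B i) (C i) (D i) (F i) (G i) s x) :=
  ⟨-K, by
    rintro _ ⟨i, rfl⟩
    exact neg_le_quot hμ.le (hA i) (hB i) (hC i) (hD i) (hF i) hK (hG i) hs.le hx⟩

theorem iInf_quot_lipschitz [Nonempty ι] (hμ : 0 < μ) (hA : ∀ i, 0 < A i) (hB : ∀ i, 0 ≤ B i)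
    (hC : ∀ i, 0 ≤ C i) (hD : ∀ i, 0 ≤ D i) (hF : ∀ i, 0 ≤ F i) (hK : 0 ≤ K)
    (hG : ∀ i, |G i| ≤ K * A i) (hk : 0 ≤ k) (hDA : ∀ i, D i ≤ k * A i)
    {a b l u : ℝ} (ha : 0 < a) (hl : 0 < l) :
    ∃ M : ℝ, 0 < M ∧ ∀ s₁ ∈ Icc a b, ∀ s₂ ∈ Icc a b, ∀ x₁ ∈ Icc l u, ∀ x₂ ∈ Icc l u,
      |(⨅ i, quot μ (A i) (B i) (C i) (D i) (F i) (G i) s₁ x₁) -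
          ⨅ i, quot μ (A i) (B i) (C i) (D i) (F i) (G i) s₂ x₂| ≤
        M * (|s₁ - s₂| + |x₁ - x₂|) := by
  let q : ι → ℝ → ℝ → ℝ := fun i => quot μ (A i) (B i) (C i) (D i) (F i) (G i)
  have hbdd : ∀ s ∈ Icc a b, ∀ x ∈ Icc l u, BddBelow (range fun i => q i s x) :=
    fun s hs x hx =>
      bddBelow_range_quot hμ hA hB hC hD hF hK hG (ha.trans_le hs.1) (hl.trans_le hx.1)
  let i₀ : ι := Classical.arbitrary ι
  obtain ⟨N, hN⟩ := quot_bounded_above (G := G i₀) hμ.le (hA i₀) (hB i₀) (hC i₀) (hD i₀) (hF i₀)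
    (b := b) (u := u) hl
  have key : ∃ M : ℝ, ∀ s₁ ∈ Icc a b, ∀ s₂ ∈ Icc a b, ∀ x₁ ∈ Icc l u, ∀ x₂ ∈ Icc l u,
      (⨅ i, q i s₂ x₂) - (⨅ i, q i s₁ x₁) ≤ M * (|s₁ - s₂| + |x₁ - x₂|) := by
    refine ⟨lipConst μ K k a b l u (|N| + 1), fun s₁ hs₁ s₂ hs₂ x₁ hx₁ x₂ hx₂ =>
      le_of_forall_pos_le_add fun ε hε => ?_⟩
    obtain ⟨i, hi⟩ := exists_lt_of_ciInf_lt
      (lt_add_of_pos_right (⨅ i, q i s₁ x₁) (lt_min hε one_pos))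
    have h₀ : (⨅ i, q i s₁ x₁) ≤ N := (ciInf_le (hbdd s₁ hs₁ x₁ hx₁) i₀).trans
      (hN s₁ hs₁.2 x₁ hx₁)
    have hiN : q i s₁ x₁ ≤ |N| + 1 := by
      linarith [le_abs_self N, min_le_right ε 1]
    have h₁ := quot_sub_le hμ (hA i) (hB i) (hC i) (hD i) (hF i) hK (hG i) hk (hDA i) ha hl
      (by positivity) hs₁ hs₂ hx₁ hx₂ hiN
    have h₂ : (⨅ i, q i s₂ x₂) ≤ q i s₂ x₂ := ciInf_le (hbdd s₂ hs₂ x₂ hx₂) i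
    refine le_trans ?_ (add_le_add_left h₁ ε)
    change _ ≤ q i s₂ x₂ - q i s₁ x₁ + ε
    linarith [min_le_left ε 1]
  obtain ⟨M, hM⟩ := key
  refine ⟨|M| + 1, by positivity, fun s₁ hs₁ s₂ hs₂ x₁ hx₁ x₂ hx₂ => ?_⟩
  have hM' : M * (|s₁ - s₂| + |x₁ - x₂|) ≤ (|M| + 1) * (|s₁ - s₂| + |x₁ - x₂|) := by
    gcongr
    linarith [le_abs_self M]
  have h₁ := hM s₁ hs₁ s₂ hs₂ x₁ hx₁ x₂ hx₂
  have h₂ := hM s₂ hs₂ s₁ hs₁ x₂ hx₂ x₁ hx₁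
  rw [abs_sub_comm s₂, abs_sub_comm x₂] at h₂
  rw [abs_sub_le_iff]
  exact ⟨h₂.trans hM', h₁.trans hM'⟩

end Infimum

section Profiles

variable {R₁ R₂ : ℝ} {ρ W : ℝ → ℝ}

/-- The admissible profiles that do not vanish identically on `[R₁, R₂]`. -/
def Profile (R₁ R₂ : ℝ) : Type :=
  {W : ℝ → ℝ // AdmW R₁ R₂ W ∧ ∃ r ∈ Icc R₁ R₂, W r ≠ 0}

theorem nonempty_profile (h : R₁ < R₂) : Nonempty (Profile R₁ R₂) := by
  refine ⟨⟨fun r => (r - R₁) * (r - R₂) ^ 2, ⟨by fun_prop, by simp, by simp, ?_⟩,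
    (R₁ + R₂) / 2, ⟨by linarith, by linarith⟩, ?_⟩⟩
  · have : HasDerivAt (fun r => (r - R₁) * (r - R₂) ^ 2)
        (1 * (R₂ - R₂) ^ 2 + (R₂ - R₁) * (2 * (R₂ - R₂) ^ 1 * 1)) R₂ :=
      ((hasDerivAt_id R₂).sub_const R₁).mul (((hasDerivAt_id R₂).sub_const R₂).pow 2)
    rw [this.deriv]
    ring
  · have h₁ : (R₁ + R₂) / 2 - R₁ ≠ 0 := by linarith
    have h₂ : (R₁ + R₂) / 2 - R₂ ≠ 0 := by linarith
    positivity

theorem contDiff_rW (hW : ContDiff ℝ 2 W) : ContDiff ℝ 2 (rW W) :=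
  contDiff_id.mul hW

theorem continuous_deriv_rW (hW : ContDiff ℝ 2 W) : Continuous (deriv (rW W)) :=
  (contDiff_rW hW).continuous_deriv (by norm_num)

theorem continuous_deriv_deriv_rW (hW : ContDiff ℝ 2 W) : Continuous (deriv (deriv (rW W))) :=
  (ContDiff.deriv' (contDiff_rW hW : ContDiff ℝ (1 + 1) _)).continuous_deriv le_rfl

/-- The weighted `L²` integral `∫_I r ρ̄ W²`. -/
def massInt (R₁ R₂ : ℝ) (ρ W : ℝ → ℝ) : ℝ := ∫ r in R₁..R₂, r * ρ r * W r ^ 2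

/-- The integral `∫_I r |DW|²`. -/
def gradInt (R₁ R₂ : ℝ) (W : ℝ → ℝ) : ℝ := ∫ r in R₁..R₂, r * deriv W r ^ 2

/-- The integral `∫_I W² / r`. -/
def invInt (R₁ R₂ : ℝ) (W : ℝ → ℝ) : ℝ := ∫ r in R₁..R₂, W r ^ 2 / r

/-- The part of `E₂` that does not depend on `ξ` and involves `D(rW)`. -/
def topOrder (R₁ R₂ μ α : ℝ) (W : ℝ → ℝ) : ℝ :=
  (∫ r in R₁..R₂, r * deriv (deriv (rW W)) r ^ 2) + (1 - α / μ * R₁) * deriv (rW W) R₁ ^ 2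

/-- The integral `∫_I g r W² Dρ̄`. -/
def gravInt (R₁ R₂ g : ℝ) (ρ W : ℝ → ℝ) : ℝ := ∫ r in R₁..R₂, g * r * W r ^ 2 * deriv ρ r

theorem intervalIntegrable_sq_div (hR₁ : 0 < R₁) (h : R₁ < R₂) (hW : Continuous W) :
    IntervalIntegrable (fun r => W r ^ 2 / r) volume R₁ R₂ := by
  refine ContinuousOn.intervalIntegrable ?_
  rw [uIcc_of_le h.le]
  exact (hW.pow 2).continuousOn.div continuousOn_id fun r hr => (hR₁.trans_le hr.1).ne'

theorem E1fun_eq (hρ : Continuous ρ) (hW : ContDiff ℝ 2 W) (ξ : ℝ) :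
    E1fun R₁ R₂ ρ ξ W = ξ ^ 2 * massInt R₁ R₂ ρ W + massInt R₁ R₂ ρ (deriv (rW W)) := by
  have h₀ := hW.continuous
  have h₁ := continuous_deriv_rW hW
  unfold E1fun massInt
  rw [← intervalIntegral.integral_const_mul, ← intervalIntegral.integral_add]
  · simp only [mul_assoc]
  all_goals exact Continuous.intervalIntegrable (by fun_prop) _ _

theorem E2fun_eq (hR₁ : 0 < R₁) (h : R₁ < R₂) (hW : ContDiff ℝ 2 W) (μ α ξ : ℝ) :
    E2fun R₁ R₂ μ α ξ W = (2 * ξ ^ 2 + 1) * gradInt R₁ R₂ W +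
      (ξ ^ 2 - 1) ^ 2 * invInt R₁ R₂ W + topOrder R₁ R₂ μ α W := by
  have h₁ : Continuous (deriv W) := hW.continuous_deriv (by norm_num)
  have h₂ := continuous_deriv_deriv_rW hW
  have hi₁ : IntervalIntegrable (fun r => (2 * ξ ^ 2 + 1) * (r * deriv W r ^ 2))
      volume R₁ R₂ := Continuous.intervalIntegrable (by fun_prop) _ _
  have hi₂ := (intervalIntegrable_sq_div hR₁ h hW.continuous).const_mul ((ξ ^ 2 - 1) ^ 2)
  have hi₃ : IntervalIntegrable (fun r => r * deriv (deriv (rW W)) r ^ 2) volume R₁ R₂ :=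
    Continuous.intervalIntegrable (by fun_prop) _ _
  unfold E2fun gradInt invInt topOrder
  rw [← intervalIntegral.integral_const_mul, ← intervalIntegral.integral_const_mul, ← add_assoc,
    ← intervalIntegral.integral_add hi₁ hi₂, ← intervalIntegral.integral_add (hi₁.add hi₂) hi₃]
  congr 2
  ext r
  ring

theorem Efun_div_E1fun_eq (hR₁ : 0 < R₁) (h : R₁ < R₂) (hρ : Continuous ρ)
    (hW : ContDiff ℝ 2 W) (μ α g s ξ : ℝ) :
    Efun R₁ R₂ μ α g ρ s ξ W / E1fun R₁ R₂ ρ ξ W =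
      quot μ (massInt R₁ R₂ ρ W) (massInt R₁ R₂ ρ (deriv (rW W))) (gradInt R₁ R₂ W)
        (invInt R₁ R₂ W) (topOrder R₁ R₂ μ α W) (gravInt R₁ R₂ g ρ W) s (ξ ^ 2) := by
  rw [Efun, E1fun_eq hρ hW, E2fun_eq hR₁ h hW, E3fun, quot, gravInt, neg_mul, ← sub_eq_add_neg]

theorem Phi_eq_iInf (hR₁ : 0 < R₁) (h : R₁ < R₂) (hρ : Continuous ρ) (μ α g s ξ : ℝ) :
    Phi R₁ R₂ μ α g ρ s ξ = ⨅ W : Profile R₁ R₂,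
      quot μ (massInt R₁ R₂ ρ W.1) (massInt R₁ R₂ ρ (deriv (rW W.1))) (gradInt R₁ R₂ W.1)
        (invInt R₁ R₂ W.1) (topOrder R₁ R₂ μ α W.1) (gravInt R₁ R₂ g ρ W.1) s (ξ ^ 2) := by
  rw [Phi, iInf]
  congr 1
  ext x
  constructor
  · rintro ⟨W, hW, hne, rfl⟩
    exact ⟨⟨W, hW, hne⟩, (Efun_div_E1fun_eq hR₁ h hρ hW.1 μ α g s ξ).symm⟩
  · rintro ⟨⟨W, hW, hne⟩, rfl⟩
    exact ⟨W, hW, hne, (Efun_div_E1fun_eq hR₁ h hρ hW.1 μ α g s ξ).symm⟩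

theorem massInt_nonneg (hR₁ : 0 < R₁) (h : R₁ < R₂) (hρpos : ∀ r ∈ Icc R₁ R₂, 0 < ρ r)
    (V : ℝ → ℝ) : 0 ≤ massInt R₁ R₂ ρ V :=
  intervalIntegral.integral_nonneg h.le fun r hr =>
    mul_nonneg (mul_pos (hR₁.trans_le hr.1) (hρpos r hr)).le (sq_nonneg _)

theorem massInt_pos (hR₁ : 0 < R₁) (h : R₁ < R₂) (hρ : Continuous ρ)
    (hρpos : ∀ r ∈ Icc R₁ R₂, 0 < ρ r) (hW : Continuous W)
    (hne : ∃ r ∈ Icc R₁ R₂, W r ≠ 0) : 0 < massInt R₁ R₂ ρ W := by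
  obtain ⟨c, hc, hWc⟩ := hne
  refine intervalIntegral.integral_pos h (by fun_prop) (fun r hr => ?_) ⟨c, hc, ?_⟩
  · have hr' := Ioc_subset_Icc_self hr
    exact mul_nonneg (mul_pos (hR₁.trans_le hr'.1) (hρpos r hr')).le (sq_nonneg _)
  · exact mul_pos (mul_pos (hR₁.trans_le hc.1) (hρpos c hc)) (by positivity)

theorem gradInt_nonneg (hR₁ : 0 < R₁) (h : R₁ < R₂) (W : ℝ → ℝ) : 0 ≤ gradInt R₁ R₂ W :=
  intervalIntegral.integral_nonneg h.le fun _ hr =>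
    mul_nonneg (hR₁.trans_le hr.1).le (sq_nonneg _)

theorem invInt_nonneg (hR₁ : 0 < R₁) (h : R₁ < R₂) (W : ℝ → ℝ) : 0 ≤ invInt R₁ R₂ W :=
  intervalIntegral.integral_nonneg h.le fun _ hr =>
    div_nonneg (sq_nonneg _) (hR₁.trans_le hr.1).le

theorem topOrder_nonneg {μ α : ℝ} (hR₁ : 0 < R₁) (h : R₁ < R₂) (hα : 0 ≤ 1 - α * R₁ / μ)
    (W : ℝ → ℝ) : 0 ≤ topOrder R₁ R₂ μ α W := by
  rw [mul_div_right_comm] at hα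
  exact add_nonneg (gradInt_nonneg hR₁ h (deriv (rW W))) (mul_nonneg hα (sq_nonneg _))

theorem exists_pos_le_density (h : R₁ < R₂) (hρ : Continuous ρ)
    (hρpos : ∀ r ∈ Icc R₁ R₂, 0 < ρ r) : ∃ m : ℝ, 0 < m ∧ ∀ r ∈ Icc R₁ R₂, m ≤ ρ r := by
  obtain ⟨r₀, hr₀, hmin⟩ :=
    isCompact_Icc.exists_isMinOn (nonempty_Icc.2 h.le) hρ.continuousOn
  exact ⟨ρ r₀, hρpos r₀ hr₀, fun r hr => hmin hr⟩

theorem exists_invInt_le (hR₁ : 0 < R₁) (h : R₁ < R₂) (hρ : Continuous ρ)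
    (hρpos : ∀ r ∈ Icc R₁ R₂, 0 < ρ r) :
    ∃ k : ℝ, 0 ≤ k ∧ ∀ W : ℝ → ℝ, Continuous W → invInt R₁ R₂ W ≤ k * massInt R₁ R₂ ρ W := by
  obtain ⟨m, hm, hmρ⟩ := exists_pos_le_density h hρ hρpos
  refine ⟨1 / (R₁ ^ 2 * m), by positivity, fun W hW => ?_⟩
  rw [massInt, ← intervalIntegral.integral_const_mul]
  refine intervalIntegral.integral_mono_on h.le (intervalIntegrable_sq_div hR₁ h hW)
    (Continuous.intervalIntegrable (by fun_prop) _ _) fun r hr => ?_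
  have hr0 : 0 < r := hR₁.trans_le hr.1
  rw [one_div_mul_eq_div, div_le_div_iff₀ hr0 (by positivity)]
  have : R₁ ^ 2 * m ≤ r ^ 2 * ρ r := by
    gcongr
    exacts [hr.1, hmρ r hr]
  nlinarith [mul_le_mul_of_nonneg_left this (sq_nonneg (W r))]

theorem exists_abs_gravInt_le (hR₁ : 0 < R₁) (h : R₁ < R₂) {g : ℝ} (hg : 0 < g)
    (hρ : ContDiff ℝ 1 ρ) (hρpos : ∀ r ∈ Icc R₁ R₂, 0 < ρ r) :
    ∃ K : ℝ, 0 ≤ K ∧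
      ∀ W : ℝ → ℝ, Continuous W → |gravInt R₁ R₂ g ρ W| ≤ K * massInt R₁ R₂ ρ W := by
  have hc := hρ.continuous
  have hd : Continuous (deriv ρ) := hρ.continuous_deriv le_rfl
  obtain ⟨m, hm, hmρ⟩ := exists_pos_le_density h hc hρpos
  obtain ⟨P, hP⟩ := isCompact_Icc.exists_bound_of_continuousOn (s := Icc R₁ R₂) hd.continuousOn
  have hP0 : 0 ≤ P := (norm_nonneg _).trans (hP R₁ (left_mem_Icc.2 h.le))
  refine ⟨g * P / m, by positivity, fun W hW => ?_⟩
  rw [massInt, ← intervalIntegral.integral_const_mul]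
  refine (intervalIntegral.abs_integral_le_integral_abs h.le).trans ?_
  refine intervalIntegral.integral_mono_on h.le
    (Continuous.intervalIntegrable (by fun_prop) _ _)
    (Continuous.intervalIntegrable (by fun_prop) _ _) fun r hr => ?_
  have hr0 : 0 < r := hR₁.trans_le hr.1
  have hPr : |deriv ρ r| ≤ P := hP r hr
  rw [abs_mul, abs_of_nonneg (by positivity)]
  calc g * r * W r ^ 2 * |deriv ρ r| ≤ g * r * W r ^ 2 * P := by gcongr
    _ = g * P / m * (r * m * W r ^ 2) := by field_simp
    _ ≤ g * P / m * (r * ρ r * W r ^ 2) := by gcongr; exact hmρ r hr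

end Profiles

theorem statement10 (R₁ R₂ μ α g : ℝ) (hR₁ : 0 < R₁) (hR₁₂ : R₁ < R₂) (hμ : 0 < μ)
    (hg : 0 < g) (hα : 0 ≤ 1 - α * R₁ / μ) (ρ : ℝ → ℝ) (hρ : ContDiff ℝ (⊤ : ℕ∞) ρ)
    (hρpos : ∀ r ∈ Icc R₁ R₂, 0 < ρ r) :
    (∀ ξ : ℝ, 0 < ξ → ∀ s₁ s₂ : ℝ, 0 < s₁ → s₁ ≤ s₂ →
      Phi R₁ R₂ μ α g ρ s₁ ξ ≤ Phi R₁ R₂ μ α g ρ s₂ ξ) ∧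
    (∀ a b c d : ℝ, 0 < a → a ≤ b → 0 < c → c ≤ d →
      ∃ M : ℝ, 0 < M ∧
        ∀ s₁ ∈ Icc a b, ∀ s₂ ∈ Icc a b, ∀ ξ₁ ∈ Icc c d, ∀ ξ₂ ∈ Icc c d,
          |Phi R₁ R₂ μ α g ρ s₁ ξ₁ - Phi R₁ R₂ μ α g ρ s₂ ξ₂| ≤
            M * (|s₁ - s₂| + |ξ₁ ^ 2 - ξ₂ ^ 2|)) := by
  have hρc : Continuous ρ := hρ.continuous
  have hρ₁ : ContDiff ℝ 1 ρ := hρ.of_le (by exact_mod_cast le_top)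
  have := nonempty_profile hR₁₂
  obtain ⟨K, hK, hGK⟩ := exists_abs_gravInt_le hR₁ hR₁₂ hg hρ₁ hρpos
  obtain ⟨k, hk, hDk⟩ := exists_invInt_le hR₁ hR₁₂ hρc hρpos
  have hA (W : Profile R₁ R₂) := massInt_pos hR₁ hR₁₂ hρc hρpos W.2.1.1.continuous W.2.2
  have hB (W : Profile R₁ R₂) := massInt_nonneg hR₁ hR₁₂ hρpos (deriv (rW W.1))
  have hC (W : Profile R₁ R₂) := gradInt_nonneg hR₁ hR₁₂ W.1
  have hD (W : Profile R₁ R₂) := invInt_nonneg hR₁ hR₁₂ W.1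
  have hF (W : Profile R₁ R₂) := topOrder_nonneg hR₁ hR₁₂ hα W.1
  have hG (W : Profile R₁ R₂) := hGK W.1 W.2.1.1.continuous
  have hDA (W : Profile R₁ R₂) := hDk W.1 W.2.1.1.continuous
  simp only [Phi_eq_iInf hR₁ hR₁₂ hρc]
  refine ⟨fun ξ hξ s₁ s₂ hs₁ hs => ?_, fun a b c d ha _ hc _ => ?_⟩
  · exact ciInf_mono (bddBelow_range_quot hμ hA hB hC hD hF hK hG hs₁ (by positivity))
      fun W => quot_mono hμ.le (hA W) (hB W) (hC W) (hD W) (hF W) hs (by positivity)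
  · obtain ⟨M, hM, hlip⟩ := iInf_quot_lipschitz hμ hA hB hC hD hF hK hG hk hDA
      (b := b) (u := d ^ 2) ha (pow_pos hc 2)
    have hsq : ∀ ξ ∈ Icc c d, ξ ^ 2 ∈ Icc (c ^ 2) (d ^ 2) := fun ξ hξ =>
      ⟨pow_le_pow_left₀ hc.le hξ.1 2, pow_le_pow_left₀ (hc.le.trans hξ.1) hξ.2 2⟩
    exact ⟨M, hM, fun s₁ hs₁ s₂ hs₂ ξ₁ hξ₁ ξ₂ hξ₂ =>
      hlip s₁ hs₁ s₂ hs₂ _ (hsq ξ₁ hξ₁) _ (hsq ξ₂ hξ₂)⟩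

end
end

section
/- For every nonzero integer k there exist a constant λ₀ > 0 and a smooth function W : I → ℝ, not identically zero, such that, writing (L f)(r) = D²f(r) + (1/r)Df(r) − ((k²+1)/r²) f(r), the fourth-order ordinary differential equation λ₀ μ { k² (L W)(r) + (4k²/r²) W(r) − D[ r · (L(D(rW)))(r) ] } − λ₀² [ ρ̄(r) k² W(r) − D( r ρ̄(r) D(rW)(r) ) ] + k² g W(r) Dρ̄(r) = 0 holds for all r ∈ I, together with the boundary conditions W(R₁) = W(R₂) = 0, DW(R₂) = 0, and D²(rW)(R₁) = (1/R₁ − α/μ) D(rW)(R₁). -/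
open Real MeasureTheory Set

noncomputable section

/-- The operator `(L f)(r) = D²f(r) + (1/r) Df(r) − ((k²+1)/r²) f(r)`. -/
def Lop (k : ℤ) (f : ℝ → ℝ) : ℝ → ℝ := fun r =>
  deriv (deriv f) r + (1 / r) * deriv f r - (((k : ℝ) ^ 2 + 1) / r ^ 2) * f r

open Filter Topology

/-- A quadratic pencil `l² M + l (c ‖·‖² + B) - N`, with `M`, `B`, `N` controlled by a compact
operator, which is nonnegative for large `l` and has `N` somewhere positive, has a nontrivial kernel
for some `l > 0`. -/
theorem exists_pos_ker_of_quadratic_pencil {E F : Type*} [NormedAddCommGroup E]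
    [InnerProductSpace ℝ E] [CompleteSpace E] [NormedAddCommGroup F] [NormedSpace ℝ F]
    (J : E →L[ℝ] F) (hJ : IsCompactOperator J) (M B N : E →ₗ[ℝ] E →ₗ[ℝ] ℝ)
    (sM : ∀ v w, M v w = M w v) (sB : ∀ v w, B v w = B w v) (sN : ∀ v w, N v w = N w v)
    {c C : ℝ} (hc : 0 < c)
    (hM : ∀ v, |M v v| ≤ C * ‖J v‖ ^ 2) (hB : ∀ v, |B v v| ≤ C * ‖J v‖ ^ 2)
    (hN : ∀ v, |N v v| ≤ C * ‖J v‖ ^ 2) (hpos : ∃ v, 0 < N v v) (Λ : ℝ)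
    (hΛ : ∀ l, Λ ≤ l → ∀ v, 0 ≤ l ^ 2 * M v v + l * (c * ‖v‖ ^ 2 + B v v) - N v v) :
    ∃ l : ℝ, 0 < l ∧ ∃ v : E, v ≠ 0 ∧
      ∀ w, l ^ 2 * M v w + l * (c * inner ℝ v w + B v w) - N v w = 0 := by
  set a : ℝ → E → ℝ := fun l v => l ^ 2 * M v v + l * (c * ‖v‖ ^ 2 + B v v) - N v v with ha
  have a_smul (l t : ℝ) (v : E) : a l (t • v) = t ^ 2 * a l v := by
    simp only [ha, map_smul, LinearMap.smul_apply, smul_eq_mul, norm_smul, Real.norm_eq_abs,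
      mul_pow, sq_abs]
    ring
  have a_add (l : ℝ) (v w : E) : a l (v + w) = a l v +
      2 * (l ^ 2 * M v w + l * (c * inner ℝ v w + B v w) - N v w) + a l w := by
    simp only [ha, map_add, LinearMap.add_apply, norm_add_sq_real, sM w v, sB w v, sN w v]
    ring
  have a_cont (v : E) : Continuous fun l => a l v := by fun_prop
  set S : Set ℝ := {l | 0 < l ∧ ∃ v, a l v < 0} with hS
  have hSne : S.Nonempty := by
    obtain ⟨v, hv⟩ := hpos
    have h0 : a 0 v < 0 := by simpa [ha] using hv
    have h1 : ∀ᶠ l in 𝓝[>] (0 : ℝ), a l v < 0 :=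
      ((a_cont v).tendsto 0).eventually (gt_mem_nhds h0) |>.filter_mono nhdsWithin_le_nhds
    obtain ⟨l, hl, hl0⟩ := (h1.and self_mem_nhdsWithin).exists
    exact ⟨l, hl0, v, hl⟩
  have hSbdd : BddAbove S := by
    refine ⟨Λ, fun l hl => ?_⟩
    obtain ⟨v, hv⟩ := hl.2
    by_contra! h
    exact absurd (hΛ l h.le v) (not_le.2 hv)
  obtain ⟨s, -, hs, hsS⟩ := exists_seq_tendsto_sSup hSne hSbdd
  set l₀ := sSup S with hl₀
  have hl₀pos : 0 < l₀ := (hsS 0).1.trans_le (le_csSup hSbdd (hsS 0))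
  have ha₀ (v : E) : 0 ≤ a l₀ v := by
    by_contra! h
    have h1 : ∀ᶠ l in 𝓝[>] l₀, a l v < 0 :=
      ((a_cont v).tendsto l₀).eventually (gt_mem_nhds h) |>.filter_mono nhdsWithin_le_nhds
    obtain ⟨l, hl, hl0⟩ := (h1.and self_mem_nhdsWithin).exists
    exact absurd (le_csSup hSbdd ⟨hl₀pos.trans hl0, v, hl⟩) (not_le.2 hl0)
  have hunit (n : ℕ) : ∃ v : E, ‖v‖ = 1 ∧ a (s n) v < 0 := by
    obtain ⟨v, hv⟩ := (hsS n).2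
    have hv0 : v ≠ 0 := by
      rintro rfl
      simp [ha] at hv
    refine ⟨‖v‖⁻¹ • v, by simp [norm_smul, norm_ne_zero_iff.2 hv0], ?_⟩
    rw [a_smul]
    exact mul_neg_of_pos_of_neg (by positivity) hv
  choose x hx1 hxa using hunit
  have hC : 0 ≤ C * ‖J (x 0)‖ ^ 2 := (abs_nonneg _).trans (hM _)
  set K : ℝ := |C| * ‖J‖ ^ 2 with hK
  have hCK (n : ℕ) : C * ‖J (x n)‖ ^ 2 ≤ K := by
    have : ‖J (x n)‖ ≤ ‖J‖ := by simpa [hx1] using J.le_opNorm (x n)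
    rw [hK]
    gcongr
    exact le_abs_self C
  have hax : Tendsto (fun n => a l₀ (x n)) atTop (𝓝 0) := by
    have hub : Tendsto (fun n => |l₀ ^ 2 - s n ^ 2| * K + |l₀ - s n| * (c + K)) atTop (𝓝 0) := by
      have : Tendsto (fun n => |l₀ ^ 2 - s n ^ 2| * K + |l₀ - s n| * (c + K)) atTop
          (𝓝 (|l₀ ^ 2 - l₀ ^ 2| * K + |l₀ - l₀| * (c + K))) :=
        (((tendsto_const_nhds.sub (hs.pow 2)).abs.mul_const K).add
          ((tendsto_const_nhds.sub hs).abs.mul_const (c + K)))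
      simpa using this
    refine squeeze_zero (fun n => ha₀ _) (fun n => ?_) hub
    have h1 : a l₀ (x n) = a (s n) (x n) + (l₀ ^ 2 - s n ^ 2) * M (x n) (x n)
        + (l₀ - s n) * (c + B (x n) (x n)) := by
      simp only [ha, hx1]
      ring
    have h2 : (l₀ ^ 2 - s n ^ 2) * M (x n) (x n) ≤ |l₀ ^ 2 - s n ^ 2| * K := by
      refine (le_abs_self _).trans ?_
      rw [abs_mul]
      gcongr
      exact (hM _).trans (hCK n)
    have h3 : (l₀ - s n) * (c + B (x n) (x n)) ≤ |l₀ - s n| * (c + K) := by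
      refine (le_abs_self _).trans ?_
      rw [abs_mul]
      gcongr
      refine (abs_add_le _ _).trans ?_
      rw [abs_of_pos hc]
      gcongr
      exact (hB _).trans (hCK n)
    linarith [hxa n]
  obtain ⟨T, hT, hTx⟩ := (isCompactOperator_iff_image_closedBall_subset_compact (σ₁₂ := RingHom.id ℝ)
    J.toLinearMap one_pos).1 hJ
  obtain ⟨y, -, φ, hφ, hy⟩ := hT.tendsto_subseq (x := fun n => J (x n))
    fun n => hTx ⟨x n, by simp [hx1], rfl⟩
  have hcoer (v : E) : l₀ * c * ‖v‖ ^ 2 ≤ a l₀ v + (l₀ ^ 2 + l₀ + 1) * (C * ‖J v‖ ^ 2) := by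
    have h1 := neg_le_of_abs_le (hM v)
    have h2 := neg_le_of_abs_le (hB v)
    have h3 := le_of_abs_le (hN v)
    simp only [ha]
    nlinarith [mul_le_mul_of_nonneg_left h1 (sq_nonneg l₀), mul_le_mul_of_nonneg_left h2 hl₀pos.le]
  have hcauchy : CauchySeq (x ∘ φ) := by
    rw [cauchySeq_iff_tendsto_dist_atTop_0]
    have hJc := cauchySeq_iff_tendsto_dist_atTop_0.1 hy.cauchySeq
    have haφ : Tendsto (fun n => a l₀ (x (φ n))) atTop (𝓝 0) := hax.comp hφ.tendsto_atTop
    have hub : Tendsto (fun p : ℕ × ℕ => (2 * a l₀ (x (φ p.1)) + 2 * a l₀ (x (φ p.2)) +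
        (l₀ ^ 2 + l₀ + 1) * (C * dist (J (x (φ p.1))) (J (x (φ p.2))) ^ 2)) / (l₀ * c)) atTop
        (𝓝 0) := by
      rw [← prod_atTop_atTop_eq] at hJc ⊢
      have h1 := haφ.comp (tendsto_fst (f := (atTop : Filter ℕ)) (g := (atTop : Filter ℕ)))
      have h2 := haφ.comp (tendsto_snd (f := (atTop : Filter ℕ)) (g := (atTop : Filter ℕ)))
      have := (((h1.const_mul 2).add (h2.const_mul 2)).add
        (((hJc.pow 2).const_mul C).const_mul (l₀ ^ 2 + l₀ + 1))).div_const (l₀ * c)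
      simpa using this
    have hsq : Tendsto (fun p : ℕ × ℕ => dist (x (φ p.1)) (x (φ p.2)) ^ 2) atTop (𝓝 0) := by
      refine squeeze_zero (fun _ => by positivity) (fun p => ?_) hub
      rw [le_div_iff₀ (by positivity)]
      have h1 := hcoer (x (φ p.1) - x (φ p.2))
      have h2 := ha₀ (x (φ p.1) + x (φ p.2))
      have h3 := a_add l₀ (x (φ p.1)) (x (φ p.2))
      have h4 := a_add l₀ (x (φ p.1)) (-x (φ p.2))
      have h5 : a l₀ (-x (φ p.2)) = a l₀ (x (φ p.2)) := by simp [ha]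
      rw [h5, ← sub_eq_add_neg] at h4
      simp only [map_neg, inner_neg_right] at h4
      rw [dist_eq_norm, dist_eq_norm, ← map_sub]
      linarith
    have := hsq.sqrt
    simpa [Real.sqrt_sq dist_nonneg] using this
  obtain ⟨v, hv⟩ := cauchySeq_tendsto_of_complete hcauchy
  have hv1 : ‖v‖ = 1 := by
    have := hv.norm
    simp only [Function.comp_def, hx1] at this
    exact tendsto_nhds_unique this tendsto_const_nhds
  have hav : a l₀ v ≤ 0 := by
    have hub : Tendsto (fun n => 2 * a l₀ (x (φ n)) +
        2 * (l₀ ^ 2 * (C * ‖J (v - x (φ n))‖ ^ 2) + l₀ * (c * ‖v - x (φ n)‖ ^ 2 +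
          C * ‖J (v - x (φ n))‖ ^ 2) + C * ‖J (v - x (φ n))‖ ^ 2)) atTop (𝓝 0) := by
      have hd : Tendsto (fun n => v - x (φ n)) atTop (𝓝 0) := by
        simpa using (tendsto_const_nhds (x := v)).sub hv
      have hJd : Tendsto (fun n => ‖J (v - x (φ n))‖) atTop (𝓝 0) := by
        simpa using ((J.continuous.tendsto 0).comp hd).norm
      have hnd : Tendsto (fun n => ‖v - x (φ n)‖) atTop (𝓝 0) := by simpa using hd.norm
      have haφ : Tendsto (fun n => a l₀ (x (φ n))) atTop (𝓝 0) := hax.comp hφ.tendsto_atTop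
      have hJ2 := (hJd.pow 2).const_mul C
      have := (haφ.const_mul 2).add ((((hJ2.const_mul (l₀ ^ 2)).add
        ((((hnd.pow 2).const_mul c).add hJ2).const_mul l₀)).add hJ2).const_mul 2)
      simpa using this
    refine ge_of_tendsto' hub fun n => ?_
    set d := v - x (φ n)
    have h1 := a_add l₀ (x (φ n)) d
    have h2 := a_add l₀ (x (φ n)) (-d)
    have h5 : a l₀ (-d) = a l₀ d := by simp [ha]
    have h6 := ha₀ (x (φ n) + -d)
    rw [h5] at h2
    simp only [map_neg, inner_neg_right] at h2
    have h7 : x (φ n) + d = v := by simp [d]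
    rw [h7] at h1
    have h8 : a l₀ d ≤ l₀ ^ 2 * (C * ‖J d‖ ^ 2) + l₀ * (c * ‖d‖ ^ 2 + C * ‖J d‖ ^ 2)
        + C * ‖J d‖ ^ 2 := by
      have h1 := le_of_abs_le (hM d)
      have h2 := le_of_abs_le (hB d)
      have h3 := neg_le_of_abs_le (hN d)
      simp only [ha]
      nlinarith [mul_le_mul_of_nonneg_left h1 (sq_nonneg l₀),
        mul_le_mul_of_nonneg_left h2 hl₀pos.le]
    linarith
  refine ⟨l₀, hl₀pos, v, fun h => by simp [h] at hv1, fun w => ?_⟩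
  set b := l₀ ^ 2 * M v w + l₀ * (c * inner ℝ v w + B v w) - N v w with hb
  have hq (t : ℝ) : 0 ≤ a l₀ w * (t * t) + 2 * b * t + 0 := by
    have h1 := ha₀ (v + t • w)
    rw [a_add, a_smul] at h1
    simp only [map_smul, smul_eq_mul, inner_smul_right] at h1
    nlinarith
  have := discrim_le_zero hq
  simp only [discrim] at this
  nlinarith [sq_nonneg b]

theorem hasDerivAt_integral_left {g : ℝ → ℝ} (hg : Continuous g) (b r : ℝ) :
    HasDerivAt (fun r => ∫ t in r..b, g t) (-g r) r :=
  intervalIntegral.integral_hasDerivAt_left (hg.intervalIntegrable _ _)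
    (hg.stronglyMeasurableAtFilter _ _) hg.continuousAt

theorem continuous_integral_left {g : ℝ → ℝ} (hg : Continuous g) (b : ℝ) :
    Continuous fun r => ∫ t in r..b, g t :=
  continuous_iff_continuousAt.2 fun r => (hasDerivAt_integral_left hg b r).continuousAt

section Curve

variable {E : Type*} [NormedAddCommGroup E] [InnerProductSpace ℝ E] {e : ℝ → E}

/-- Pairing against a continuous curve is a compact operator into the continuous functions. -/
theorem exists_isCompactOperator_inner_curve (he : Continuous e) (a b : ℝ) :
    ∃ J : E →L[ℝ] BoundedContinuousFunction (Icc a b) ℝ,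
      IsCompactOperator J ∧ ∀ v r, J v r = inner ℝ (e r) v := by
  obtain ⟨C, hC⟩ := (isCompact_Icc (a := a) (b := b)).exists_bound_of_continuousOn he.continuousOn
  set L : E →ₗ[ℝ] BoundedContinuousFunction (Icc a b) ℝ :=
    { toFun := fun v => BoundedContinuousFunction.mkOfCompact
        ⟨fun r => inner ℝ (e r) v, by fun_prop⟩
      map_add' := fun v w => by ext r; simp [inner_add_right]
      map_smul' := fun t v => by ext r; simp [inner_smul_right] } with hL
  have hLapp (v : E) (r : Icc a b) : L v r = inner ℝ (e r) v := rfl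
  have hbound (v : E) : ‖L v‖ ≤ |C| * ‖v‖ := by
    refine (BoundedContinuousFunction.norm_le (by positivity)).2 fun r => ?_
    rw [hLapp]
    refine (norm_inner_le_norm _ _).trans ?_
    gcongr
    exact (hC r r.2).trans (le_abs_self C)
  refine ⟨L.mkContinuous _ hbound, ?_, hLapp⟩
  refine (isCompactOperator_iff_image_closedBall_subset_compact (σ₁₂ := RingHom.id ℝ) L one_pos).2
    ⟨_, BoundedContinuousFunction.arzela_ascoli (Icc (-|C|) |C|) isCompact_Icc
      (L '' Metric.closedBall 0 1) ?_ ?_, subset_closure⟩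
  · rintro _ r ⟨v, hv, rfl⟩
    refine abs_le.1 (((L v).norm_coe_le_norm r).trans ((hbound v).trans ?_))
    exact mul_le_of_le_one_right (abs_nonneg _) (by simpa using hv)
  · intro r
    rw [Metric.equicontinuousAt_iff]
    intro ε hε
    have hcont : Continuous fun r : Icc a b => e r := by fun_prop
    obtain ⟨δ, hδ, h⟩ := Metric.continuousAt_iff.1 (hcont.continuousAt (x := r)) ε hε
    refine ⟨δ, hδ, fun t ht => ?_⟩
    rintro ⟨_, v, hv, rfl⟩
    have hv1 : ‖v‖ ≤ 1 := by simpa using hv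
    have h2 := h ht
    rw [dist_eq_norm] at h2
    change dist (L v r) (L v t) < ε
    rw [dist_comm, dist_eq_norm, hLapp, hLapp, ← inner_sub_left]
    exact (norm_inner_le_norm _ _).trans_lt
      ((mul_le_of_le_one_right (norm_nonneg _) hv1).trans_lt h2)

/-- The bilinear form `∫ (P X X + Q Y Y) + γ X(a) X(a)`, where `X(r) = ⟪e r, ·⟫` and
`Y(r) = ∫ t in r..b, X(t)`. -/
theorem exists_curve_form (he : Continuous e) (a b : ℝ) {P Q : ℝ → ℝ} (hP : Continuous P)
    (hQ : Continuous Q) (γ : ℝ) : ∃ B : E →ₗ[ℝ] E →ₗ[ℝ] ℝ, ∀ v w, B v w =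
      (∫ r in a..b, (P r * (inner ℝ (e r) v * inner ℝ (e r) w) + Q r *
        ((∫ t in r..b, inner ℝ (e t) v) * ∫ t in r..b, inner ℝ (e t) w))) +
      γ * (inner ℝ (e a) v * inner ℝ (e a) w) := by
  have hX (v : E) : Continuous fun r => (inner ℝ (e r) v : ℝ) := by fun_prop
  have hY (v : E) := continuous_integral_left (hX v) b
  have hYadd (v w : E) (r : ℝ) : ∫ t in r..b, (inner ℝ (e t) (v + w) : ℝ) =
      (∫ t in r..b, inner ℝ (e t) v) + ∫ t in r..b, inner ℝ (e t) w := by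
    simp only [inner_add_right]
    exact intervalIntegral.integral_add ((hX v).intervalIntegrable _ _)
      ((hX w).intervalIntegrable _ _)
  have hYsmul (s : ℝ) (v : E) (r : ℝ) : ∫ t in r..b, (inner ℝ (e t) (s • v) : ℝ) =
      s * ∫ t in r..b, inner ℝ (e t) v := by
    simp only [inner_smul_right]
    exact intervalIntegral.integral_const_mul _ _
  have hintegrable (v w : E) : IntervalIntegrable (fun r => P r * (inner ℝ (e r) v * inner ℝ (e r) w) +
      Q r * ((∫ t in r..b, inner ℝ (e t) v) * ∫ t in r..b, inner ℝ (e t) w)) volume a b :=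
    ((hP.mul ((hX v).mul (hX w))).add (hQ.mul ((hY v).mul (hY w)))).intervalIntegrable _ _
  refine ⟨LinearMap.mk₂ ℝ _ ?_ ?_ ?_ ?_, fun v w => LinearMap.mk₂_apply ..⟩
  · intro u v w
    simp only [hYadd]
    simp only [inner_add_right]
    rw [show ∀ x y z t : ℝ, x + y + (z + t) = (x + z) + (y + t) by intros; ring,
      ← intervalIntegral.integral_add (hintegrable _ _) (hintegrable _ _)]
    congr 1
    · congr 1; ext r; ring
    · ring
  · intro s v w
    simp only [hYsmul]
    simp only [inner_smul_right, smul_eq_mul]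
    rw [mul_add, ← intervalIntegral.integral_const_mul]
    congr 1
    · congr 1; ext r; ring
    · ring
  · intro u v w
    simp only [hYadd]
    simp only [inner_add_right]
    rw [show ∀ x y z t : ℝ, x + y + (z + t) = (x + z) + (y + t) by intros; ring,
      ← intervalIntegral.integral_add (hintegrable _ _) (hintegrable _ _)]
    congr 1
    · congr 1; ext r; ring
    · ring
  · intro s v w
    simp only [hYsmul]
    simp only [inner_smul_right, smul_eq_mul]
    rw [mul_add, ← intervalIntegral.integral_const_mul]
    congr 1
    · congr 1; ext r; ring
    · ring

theorem exists_curve_form_bound (e : ℝ → E) {a b : ℝ} (hab : a ≤ b) {P Q : ℝ → ℝ}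
    (hP : Continuous P) (hQ : Continuous Q) (γ : ℝ) : ∃ C : ℝ, ∀ v : E, ∀ m : ℝ, 0 ≤ m →
      (∀ r ∈ Icc a b, |(inner ℝ (e r) v : ℝ)| ≤ m) →
      |(∫ r in a..b, (P r * (inner ℝ (e r) v * inner ℝ (e r) v) + Q r *
        ((∫ t in r..b, inner ℝ (e t) v) * ∫ t in r..b, inner ℝ (e t) v))) +
      γ * (inner ℝ (e a) v * inner ℝ (e a) v)| ≤ C * m ^ 2 := by
  obtain ⟨p, hp⟩ := (isCompact_Icc (a := a) (b := b)).exists_bound_of_continuousOn hP.continuousOn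
  obtain ⟨q, hq⟩ := (isCompact_Icc (a := a) (b := b)).exists_bound_of_continuousOn hQ.continuousOn
  refine ⟨(p + q * (b - a) ^ 2) * (b - a) + |γ|, fun v m hm hv => ?_⟩
  have hY : ∀ r ∈ Icc a b, |∫ t in r..b, (inner ℝ (e t) v : ℝ)| ≤ m * (b - a) := by
    intro r hr
    have := intervalIntegral.norm_integral_le_of_norm_le_const (a := r) (b := b) (C := m)
      (f := fun t => (inner ℝ (e t) v : ℝ)) fun t ht => by
        rw [uIoc_of_le hr.2] at ht
        exact hv t ⟨hr.1.trans ht.1.le, ht.2⟩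
    rw [abs_of_nonneg (by linarith [hr.2])] at this
    refine this.trans ?_
    gcongr
    exact hr.1
  have h1 := intervalIntegral.norm_integral_le_of_norm_le_const (a := a) (b := b)
    (C := (p + q * (b - a) ^ 2) * m ^ 2)
    (f := fun r => (P r * (inner ℝ (e r) v * inner ℝ (e r) v) + Q r *
        ((∫ t in r..b, inner ℝ (e t) v) * ∫ t in r..b, inner ℝ (e t) v))) fun r hr => by
      rw [uIoc_of_le hab] at hr
      have hr' : r ∈ Icc a b := ⟨hr.1.le, hr.2⟩
      refine (norm_add_le _ _).trans ?_
      simp only [norm_mul, Real.norm_eq_abs]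
      have h1 : |P r| * (|(inner ℝ (e r) v : ℝ)| * |(inner ℝ (e r) v : ℝ)|) ≤ p * (m * m) := by
        have := hv r hr'
        have hp0 := (norm_nonneg _).trans (hp r hr')
        gcongr
        exact hp r hr'
      have h2 : |Q r| * (|∫ t in r..b, (inner ℝ (e t) v : ℝ)| *
          |∫ t in r..b, (inner ℝ (e t) v : ℝ)|) ≤ q * ((m * (b - a)) * (m * (b - a))) := by
        have := hY r hr'
        have hq0 := (norm_nonneg _).trans (hq r hr')
        have : 0 ≤ m * (b - a) := mul_nonneg hm (sub_nonneg.2 hab)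
        gcongr
        exact hq r hr'
      linarith
  rw [abs_of_nonneg (sub_nonneg.2 hab)] at h1
  have h2 : |γ * (inner ℝ (e a) v * inner ℝ (e a) v : ℝ)| ≤ |γ| * (m * m) := by
    have := hv a ⟨le_rfl, hab⟩
    rw [abs_mul, abs_mul]
    gcongr
  refine (abs_add_le _ _).trans ((add_le_add h1 h2).trans_eq (by ring))

theorem exists_critical_of_curve_pencil [CompleteSpace E] (he : Continuous e) {a b : ℝ}
    (hab : a ≤ b) {P₁ P₂ Q₀ Q₁ Q₂ : ℝ → ℝ} (hP₁ : Continuous P₁) (hP₂ : Continuous P₂)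
    (hQ₀ : Continuous Q₀) (hQ₁ : Continuous Q₁) (hQ₂ : Continuous Q₂) {γ c : ℝ} (hγ : 0 ≤ γ)
    (hc : 0 < c) (hP₁0 : ∀ r ∈ Icc a b, 0 ≤ P₁ r) (hP₂0 : ∀ r ∈ Icc a b, 0 ≤ P₂ r) {Λ : ℝ}
    (hΛ0 : 0 ≤ Λ)
    (hΛ : ∀ l, Λ ≤ l → ∀ r ∈ Icc a b, 0 ≤ l ^ 2 * Q₂ r + l * Q₁ r - Q₀ r)
    (hpos : ∃ v : E, ∫ r in a..b, (inner ℝ (e r) v : ℝ) = 0 ∧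
      0 < ∫ r in a..b, Q₀ r * (∫ t in r..b, (inner ℝ (e t) v : ℝ)) ^ 2) :
    ∃ l : ℝ, 0 < l ∧ ∃ v : E, v ≠ 0 ∧ ∫ r in a..b, (inner ℝ (e r) v : ℝ) = 0 ∧
      ∀ w : E, ∫ r in a..b, (inner ℝ (e r) w : ℝ) = 0 →
        l * c * inner ℝ v w + (∫ r in a..b, ((l ^ 2 * P₂ r + l * P₁ r) *
          (inner ℝ (e r) v * inner ℝ (e r) w) + (l ^ 2 * Q₂ r + l * Q₁ r - Q₀ r) *
          ((∫ t in r..b, inner ℝ (e t) v) * ∫ t in r..b, inner ℝ (e t) w))) +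
        l * γ * (inner ℝ (e a) v * inner ℝ (e a) w) = 0 := by
  obtain ⟨J, hJ, hJe⟩ := exists_isCompactOperator_inner_curve he a b
  obtain ⟨M, hM⟩ := exists_curve_form he a b hP₂ hQ₂ 0
  obtain ⟨B, hB⟩ := exists_curve_form he a b hP₁ hQ₁ γ
  obtain ⟨N, hN⟩ := exists_curve_form he a b (P := fun _ => 0) continuous_const hQ₀ 0
  obtain ⟨CM, hCM⟩ := exists_curve_form_bound e hab hP₂ hQ₂ 0
  obtain ⟨CB, hCB⟩ := exists_curve_form_bound e hab hP₁ hQ₁ γ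
  obtain ⟨CN, hCN⟩ := exists_curve_form_bound e hab (P := fun _ => 0) continuous_const hQ₀ 0
  have hX (v : E) : Continuous fun r => (inner ℝ (e r) v : ℝ) := by fun_prop
  have hY (v : E) := continuous_integral_left (hX v) b
  have key (l : ℝ) (v w : E) : l ^ 2 * M v w + l * (c * inner ℝ v w + B v w) - N v w =
      l * c * inner ℝ v w + (∫ r in a..b, ((l ^ 2 * P₂ r + l * P₁ r) *
          (inner ℝ (e r) v * inner ℝ (e r) w) + (l ^ 2 * Q₂ r + l * Q₁ r - Q₀ r) *
          ((∫ t in r..b, inner ℝ (e t) v) * ∫ t in r..b, inner ℝ (e t) w))) +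
        l * γ * (inner ℝ (e a) v * inner ℝ (e a) w) := by
    have hintegrable {P Q : ℝ → ℝ} (hP : Continuous P) (hQ : Continuous Q) :
        Continuous (fun r => P r * (inner ℝ (e r) v * inner ℝ (e r) w) +
        Q r * ((∫ t in r..b, inner ℝ (e t) v) * ∫ t in r..b, inner ℝ (e t) w)) :=
      (hP.mul ((hX v).mul (hX w))).add (hQ.mul ((hY v).mul (hY w)))
    have h1 := (hintegrable hP₂ hQ₂).const_mul (l ^ 2)
    have h2 := (hintegrable hP₁ hQ₁).const_mul l
    have h12 := h1.add h2
    simp only [Pi.add_def] at h12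
    have h3 := hintegrable (P := fun _ => 0) continuous_const hQ₀
    have : (∫ r in a..b, ((l ^ 2 * P₂ r + l * P₁ r) *
          (inner ℝ (e r) v * inner ℝ (e r) w) + (l ^ 2 * Q₂ r + l * Q₁ r - Q₀ r) *
          ((∫ t in r..b, inner ℝ (e t) v) * ∫ t in r..b, inner ℝ (e t) w))) =
        l ^ 2 * (∫ r in a..b, (P₂ r * (inner ℝ (e r) v * inner ℝ (e r) w) + Q₂ r *
        ((∫ t in r..b, inner ℝ (e t) v) * ∫ t in r..b, inner ℝ (e t) w))) +
        l * (∫ r in a..b, (P₁ r * (inner ℝ (e r) v * inner ℝ (e r) w) + Q₁ r *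
        ((∫ t in r..b, inner ℝ (e t) v) * ∫ t in r..b, inner ℝ (e t) w))) -
        (∫ r in a..b, (0 * (inner ℝ (e r) v * inner ℝ (e r) w) + Q₀ r *
        ((∫ t in r..b, inner ℝ (e t) v) * ∫ t in r..b, inner ℝ (e t) w))) := by
      rw [← intervalIntegral.integral_const_mul, ← intervalIntegral.integral_const_mul,
        ← intervalIntegral.integral_add (h1.intervalIntegrable _ _) (h2.intervalIntegrable _ _),
        ← intervalIntegral.integral_sub (h12.intervalIntegrable _ _)
          (h3.intervalIntegrable _ _)]
      congr 1
      ext r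
      ring
    rw [this, hM, hB, hN]
    ring
  set z : E := ∫ r in a..b, e r with hz
  have hzv (v : E) : (inner ℝ z v : ℝ) = ∫ r in a..b, (inner ℝ (e r) v : ℝ) := by
    rw [hz, real_inner_comm]
    have := ((innerSL ℝ) v).intervalIntegral_comp_comm (he.intervalIntegrable a b (μ := volume))
    simp only [innerSL_apply_apply] at this
    rw [← this]
    simp only [real_inner_comm]
  set K : Submodule ℝ E := (ℝ ∙ z)ᗮ with hK
  have hmem (v : E) : v ∈ K ↔ ∫ r in a..b, (inner ℝ (e r) v : ℝ) = 0 := by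
    rw [hK, Submodule.mem_orthogonal_singleton_iff_inner_right, hzv]
  have hsup (v : E) : ∀ r ∈ Icc a b, |(inner ℝ (e r) v : ℝ)| ≤ ‖J v‖ := fun r hr => by
    have := (J v).norm_coe_le_norm ⟨r, hr⟩
    rwa [hJe] at this
  obtain ⟨l, hl, v, hv0, hv⟩ := exists_pos_ker_of_quadratic_pencil (E := K)
    (J.comp K.subtypeL) (hJ.comp_clm K.subtypeL)
    (M.compl₁₂ K.subtype K.subtype) (B.compl₁₂ K.subtype K.subtype)
    (N.compl₁₂ K.subtype K.subtype)
    (fun v w => by simp [hM, mul_comm]) (fun v w => by simp [hB, mul_comm])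
    (fun v w => by simp [hN, mul_comm]) hc (C := max CM (max CB CN))
    (fun v => by
      have := hCM v _ (norm_nonneg (J v)) (hsup v)
      rw [← hM] at this
      exact this.trans (mul_le_mul_of_nonneg_right (by simp) (by positivity)))
    (fun v => by
      have := hCB v _ (norm_nonneg (J v)) (hsup v)
      rw [← hB] at this
      exact this.trans (mul_le_mul_of_nonneg_right (by simp) (by positivity)))
    (fun v => by
      have := hCN v _ (norm_nonneg (J v)) (hsup v)
      rw [← hN] at this
      exact this.trans (mul_le_mul_of_nonneg_right (by simp) (by positivity)))
    (by
      obtain ⟨v, hv, hv'⟩ := hpos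
      refine ⟨⟨v, (hmem v).2 hv⟩, ?_⟩
      simpa [hN, ← sq] using hv') Λ
    (fun l hl v => by
      have h := key l v v
      rw [real_inner_self_eq_norm_sq] at h
      change 0 ≤ l ^ 2 * M v v + l * (c * ‖(v : E)‖ ^ 2 + B v v) - N v v
      rw [h]
      have hl0 := hΛ0.trans hl
      have : 0 ≤ ∫ r in a..b, ((l ^ 2 * P₂ r + l * P₁ r) *
          (inner ℝ (e r) (v : E) * inner ℝ (e r) (v : E)) + (l ^ 2 * Q₂ r + l * Q₁ r - Q₀ r) *
          ((∫ t in r..b, inner ℝ (e t) (v : E)) * ∫ t in r..b, inner ℝ (e t) (v : E))) := by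
        refine intervalIntegral.integral_nonneg hab fun r hr => ?_
        have h1 := hP₁0 r hr
        have h2 := hP₂0 r hr
        have h3 := hΛ l hl r hr
        exact add_nonneg (mul_nonneg (by positivity) (mul_self_nonneg _))
          (mul_nonneg h3 (mul_self_nonneg _))
      have h4 := mul_nonneg (mul_nonneg hl0 hγ) (mul_self_nonneg (inner ℝ (e a) (v : E)))
      have h5 : 0 ≤ l * c * ‖(v : E)‖ ^ 2 := by positivity
      linarith)
  refine ⟨l, hl, v, by simpa using hv0, (hmem v).1 v.2, fun w hw => ?_⟩
  rw [← key]
  exact hv ⟨w, (hmem w).2 hw⟩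

end Curve

section WeightedL2

open scoped NNReal ENNReal symmDiff

/-- Solution of the weak eigenvalue problem for the pencil with leading coefficient `l * c * r`. -/
theorem exists_weak_critical {a b : ℝ} (ha : 0 < a)
    (hab : a ≤ b) {P₁ P₂ Q₀ Q₁ Q₂ : ℝ → ℝ} (hP₁ : Continuous P₁) (hP₂ : Continuous P₂)
    (hQ₀ : Continuous Q₀) (hQ₁ : Continuous Q₁) (hQ₂ : Continuous Q₂) {γ c : ℝ} (hγ : 0 ≤ γ)
    (hc : 0 < c) (hP₁0 : ∀ r ∈ Icc a b, 0 ≤ P₁ r) (hP₂0 : ∀ r ∈ Icc a b, 0 ≤ P₂ r) {Λ : ℝ}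
    (hΛ0 : 0 ≤ Λ)
    (hΛ : ∀ l, Λ ≤ l → ∀ r ∈ Icc a b, 0 ≤ l ^ 2 * Q₂ r + l * Q₁ r - Q₀ r)
    (hpos : ∃ φ : ℝ → ℝ, Continuous φ ∧ ∫ r in a..b, ∫ t in r..b, φ t = 0 ∧
      0 < ∫ r in a..b, Q₀ r * (∫ s in r..b, ∫ t in s..b, φ t) ^ 2) :
    ∃ l : ℝ, 0 < l ∧ ∃ f : ℝ → ℝ, Integrable f ∧ ¬ (f =ᵐ[volume.restrict (Ioc a b)] 0) ∧
      ∫ r in a..b, ∫ t in r..b, f t = 0 ∧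
      ∀ φ : ℝ → ℝ, Continuous φ → ∫ r in a..b, ∫ t in r..b, φ t = 0 →
        l * c * (∫ r in a..b, r * f r * φ r) + (∫ r in a..b, ((l ^ 2 * P₂ r + l * P₁ r) *
          ((∫ t in r..b, f t) * ∫ t in r..b, φ t) + (l ^ 2 * Q₂ r + l * Q₁ r - Q₀ r) *
          ((∫ s in r..b, ∫ t in s..b, f t) * ∫ s in r..b, ∫ t in s..b, φ t))) +
        l * γ * ((∫ t in a..b, f t) * ∫ t in a..b, φ t) = 0 := by
  have hm (s : ℝ) : 0 < max s a := ha.trans_le (le_max_right _ _)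
  have hdc : Continuous fun s : ℝ => (max s a)⁻¹ :=
    (continuous_id.max continuous_const).inv₀ fun s => (hm s).ne'
  set d : ℝ → ℝ≥0 := fun s => Real.toNNReal (max s a)⁻¹ with hd
  have hdm : Measurable d := (continuous_real_toNNReal.comp hdc).measurable
  have hdv (s : ℝ) : (d s : ℝ) = (max s a)⁻¹ := Real.coe_toNNReal _ (inv_nonneg.2 (hm s).le)
  set ν : Measure ℝ := (volume.restrict (Ioc a b)).withDensity fun s => (d s : ℝ≥0∞) with hν
  have hfin : IsFiniteMeasure ν := by
    refine isFiniteMeasure_withDensity_ofReal (f := fun s => (max s a)⁻¹) ?_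
    exact ((hdc.continuousOn.integrableOn_compact isCompact_Icc).mono_set
      Ioc_subset_Icc_self).hasFiniteIntegral
  have hνle (s : Set ℝ) (hs : MeasurableSet s) : ν s ≤ ENNReal.ofReal a⁻¹ * volume s := by
    rw [hν, withDensity_apply _ hs]
    calc ∫⁻ x in s, (d x : ℝ≥0∞) ∂volume.restrict (Ioc a b)
        ≤ ∫⁻ _ in s, ENNReal.ofReal a⁻¹ ∂volume.restrict (Ioc a b) := by
          refine lintegral_mono fun x => ENNReal.ofReal_le_ofReal ?_
          exact inv_anti₀ ha (le_max_right _ _)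
      _ = ENNReal.ofReal a⁻¹ * volume.restrict (Ioc a b) s := setLIntegral_const _ _
      _ ≤ ENNReal.ofReal a⁻¹ * volume s := by gcongr; exact Measure.restrict_le_self
  have hν0 : volume.restrict (Ioc a b) ≪ ν :=
    withDensity_absolutelyContinuous' hdm.coe_nnreal_ennreal.aemeasurable
      (Eventually.of_forall fun s => by simp [hd, ha])
  have hνs (s : Set ℝ) (hs : MeasurableSet s) (f : ℝ → ℝ) :
      ∫ x in s, f x ∂ν = ∫ x in s, (max x a)⁻¹ * f x ∂volume.restrict (Ioc a b) := by
    rw [hν, setIntegral_withDensity_eq_setIntegral_smul hdm _ hs]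
    simp only [NNReal.smul_def, hdv, smul_eq_mul]
  set e : ℝ → Lp ℝ 2 ν := fun r =>
    indicatorConstLp 2 (measurableSet_Ioc (a := r) (b := b)) (measure_ne_top ν _) (1 : ℝ) with he
  have hec : Continuous e := by
    refine continuous_indicatorConstLp_set (by simp) fun x => ?_
    refine tendsto_of_tendsto_of_tendsto_of_le_of_le tendsto_const_nhds (?_ : Tendsto
      (fun y => ENNReal.ofReal a⁻¹ * ENNReal.ofReal |y - x|) (𝓝 x) (𝓝 0)) (fun _ => bot_le) ?_
    · have : Continuous fun y => ENNReal.ofReal a⁻¹ * ENNReal.ofReal |y - x| :=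
        (ENNReal.continuous_const_mul ENNReal.ofReal_ne_top).comp
          (ENNReal.continuous_ofReal.comp (by fun_prop))
      simpa using this.tendsto x
    · intro y
      refine (measure_mono (?_ : _ ⊆ uIoc x y)).trans ((hνle _ measurableSet_uIoc).trans_eq ?_)
      · intro t ht
        rw [mem_symmDiff] at ht
        rw [mem_uIoc]
        simp only [mem_Ioc, not_and_or, not_lt, not_le] at ht
        grind
      · rw [Real.volume_uIoc]
  have hfint (v : Lp ℝ 2 ν) :
      Integrable (fun s => (max s a)⁻¹ * v s) (volume.restrict (Ioc a b)) := by
    have := (integrable_withDensity_iff_integrable_smul hdm).1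
      ((Lp.memLp v).integrable one_le_two)
    simpa [NNReal.smul_def, hdv] using this
  have hX (v : Lp ℝ 2 ν) (r : ℝ) (hr : r ∈ Icc a b) :
      (inner ℝ (e r) v : ℝ) = ∫ t in r..b, (max t a)⁻¹ * v t := by
    rw [he, L2.inner_indicatorConstLp_one, hνs _ measurableSet_Ioc, Measure.restrict_restrict measurableSet_Ioc,
      inter_eq_left.2 (Ioc_subset_Ioc_left hr.1), intervalIntegral.integral_of_le hr.2]
  have hind (v : Lp ℝ 2 ν) (r : ℝ) (hr : r ∈ Icc a b) :
      ∫ t in r..b, (Ioc a b).indicator (fun t => (max t a)⁻¹ * v t) t = inner ℝ (e r) v := by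
    rw [hX v r hr]
    refine intervalIntegral.integral_congr_ae (Eventually.of_forall fun t ht => ?_)
    rw [uIoc_of_le hr.2] at ht
    exact indicator_of_mem (show t ∈ Ioc a b from ⟨hr.1.trans_lt ht.1, ht.2⟩) _
  have hw (φ : ℝ → ℝ) (hφ : Continuous φ) : ∃ w : Lp ℝ 2 ν, (∀ r ∈ Icc a b,
      (inner ℝ (e r) w : ℝ) = ∫ t in r..b, φ t) ∧ ∀ v : Lp ℝ 2 ν, (inner ℝ v w : ℝ) =
        ∫ r in a..b, r * (Ioc a b).indicator (fun t => (max t a)⁻¹ * v t) r * φ r := by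
    have hcont : Continuous fun s => max s a * φ s := (continuous_id.max continuous_const).mul hφ
    obtain ⟨C, hC⟩ :=
      (isCompact_Icc (a := a) (b := b)).exists_bound_of_continuousOn hcont.continuousOn
    have hmem : MemLp (fun s => max s a * φ s) 2 ν := by
      refine MemLp.of_bound hcont.aestronglyMeasurable C ?_
      refine (withDensity_absolutelyContinuous _ _).ae_le ?_
      filter_upwards [ae_restrict_mem measurableSet_Ioc] with s hs
      exact hC s (Ioc_subset_Icc_self hs)
    have hae : hmem.toLp =ᵐ[volume.restrict (Ioc a b)] fun s => max s a * φ s :=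
      hν0.ae_le hmem.coeFn_toLp
    refine ⟨hmem.toLp, fun r hr => ?_, fun v => ?_⟩
    · rw [hX _ r hr]
      refine intervalIntegral.integral_congr_ae ?_
      rw [uIoc_of_le hr.2]
      filter_upwards [(ae_restrict_iff' measurableSet_Ioc).1 hae] with s hs hs'
      rw [hs ⟨hr.1.trans_lt hs'.1, hs'.2⟩, inv_mul_cancel_left₀ (hm s).ne']
    · rw [L2.inner_def, ← setIntegral_univ, hνs _ MeasurableSet.univ, setIntegral_univ,
        intervalIntegral.integral_of_le hab]
      refine integral_congr_ae ?_
      filter_upwards [hae, ae_restrict_mem measurableSet_Ioc] with s hs hs'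
      have h0 : s ≠ 0 := (ha.trans hs'.1).ne'
      simp only [hs, hs', indicator_of_mem, RCLike.inner_apply,
        conj_trivial, max_eq_left hs'.1.le]
      field_simp
  have hYc {F G : ℝ → ℝ} (h : ∀ r ∈ Icc a b, F r = G r) (r : ℝ) (hr : r ∈ Icc a b) :
      ∫ t in r..b, F t = ∫ t in r..b, G t :=
    intervalIntegral.integral_congr fun t ht => by
      rw [uIcc_of_le hr.2] at ht
      exact h t ⟨hr.1.trans ht.1, ht.2⟩
  obtain ⟨l, hl, v, hv0, hvK, hv⟩ := exists_critical_of_curve_pencil hec hab hP₁ hP₂ hQ₀ hQ₁ hQ₂ hγ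
    hc hP₁0 hP₂0 hΛ0 hΛ (by
      obtain ⟨φ, hφ, h1, h2⟩ := hpos
      obtain ⟨w, hw1, -⟩ := hw φ hφ
      refine ⟨w, (hYc hw1 a ⟨le_rfl, hab⟩).trans h1, h2.trans_eq ?_⟩
      exact (hYc (fun r hr => by rw [hYc hw1 r hr]) a ⟨le_rfl, hab⟩).symm)
  refine ⟨l, hl, (Ioc a b).indicator fun t => (max t a)⁻¹ * v t,
    (integrable_indicator_iff measurableSet_Ioc).2 (hfint v), fun h => hv0 ?_,
    (hYc (hind v) a ⟨le_rfl, hab⟩).trans hvK, fun φ hφ h => ?_⟩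
  · rw [Lp.eq_zero_iff_ae_eq_zero]
    refine (withDensity_absolutelyContinuous _ _).ae_le ?_
    filter_upwards [h, ae_restrict_mem measurableSet_Ioc] with s hs hs'
    rw [indicator_of_mem hs'] at hs
    simpa [(hm s).ne'] using hs
  · obtain ⟨w, hw1, hw2⟩ := hw φ hφ
    have := hv w ((hYc hw1 a ⟨le_rfl, hab⟩).trans h)
    rw [← this, hw2 v]
    congr 1
    · refine congrArg₂ (· + ·) rfl ?_
      refine hYc (fun r hr => ?_) a ⟨le_rfl, hab⟩
      rw [hind v r hr, hw1 r hr, hYc (hind v) r hr, hYc hw1 r hr]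
    · rw [hind v a ⟨le_rfl, hab⟩, hw1 a ⟨le_rfl, hab⟩]

end WeightedL2

section EulerLagrange

theorem integral_mul_eq_add_integral_deriv_mul {G G' φ : ℝ → ℝ}
    (hG : ∀ r, HasDerivAt G (G' r) r) (hG' : Continuous G') (hφ : Continuous φ) (a b : ℝ) :
    ∫ r in a..b, G r * φ r =
      G a * (∫ t in a..b, φ t) + ∫ r in a..b, G' r * ∫ t in r..b, φ t := by
  have := intervalIntegral.integral_mul_deriv_eq_deriv_mul (a := a) (b := b) (u := G) (u' := G')
    (v := fun r => -∫ t in r..b, φ t) (v' := φ) (fun r _ => hG r)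
    (fun r _ => (hasDerivAt_integral_left hφ b r).neg.congr_deriv (neg_neg _))
    (hG'.intervalIntegrable _ _) (hφ.intervalIntegrable _ _)
  rw [this]
  simp

theorem ae_eq_zero_of_integral_mul_eq_zero {a b : ℝ} (hab : a ≤ b) {F : ℝ → ℝ}
    (hF : IntervalIntegrable F volume a b)
    (h : ∀ φ : ℝ → ℝ, Continuous φ → ∫ r in a..b, F r * φ r = 0) :
    F =ᵐ[volume.restrict (Ioc a b)] 0 := by
  have hF' := ((intervalIntegrable_iff_integrableOn_Ioc_of_le hab).1 hF)
  refine ae_eq_zero_of_integral_contDiff_smul_eq_zero hF'.integrable.locallyIntegrable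
    fun φ hφ _ => ?_
  rw [← h φ hφ.continuous, intervalIntegral.integral_of_le hab]
  simp [mul_comm]

/-- Euler–Lagrange equations of the weak problem, as a first-order system. -/
theorem exists_system_of_weak {a b : ℝ} (hab : a < b) {f P Q : ℝ → ℝ} (hf : Integrable f)
    (hP : Continuous P) (hQ : Continuous Q) {C γ : ℝ}
    (hweak : ∀ φ : ℝ → ℝ, Continuous φ → ∫ r in a..b, ∫ t in r..b, φ t = 0 →
      C * (∫ r in a..b, r * f r * φ r) +
        (∫ r in a..b, (P r * ((∫ t in r..b, f t) * ∫ t in r..b, φ t) +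
          Q r * ((∫ s in r..b, ∫ t in s..b, f t) * ∫ s in r..b, ∫ t in s..b, φ t))) +
        γ * ((∫ t in a..b, f t) * ∫ t in a..b, φ t) = 0) :
    ∃ q n : ℝ → ℝ, q a = -(γ * ∫ t in a..b, f t) ∧
      (∀ r, HasDerivAt q (n r - P r * ∫ t in r..b, f t) r) ∧
      (∀ r, HasDerivAt n (-(Q r * ∫ s in r..b, ∫ t in s..b, f t)) r) ∧
      (fun r => C * r * f r) =ᵐ[volume.restrict (Ioc a b)] q := by
  set X : ℝ → ℝ := fun r => ∫ t in r..b, f t with hX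
  have hXc : Continuous X := by
    have : X = fun r => -∫ t in b..r, f t := funext fun r => intervalIntegral.integral_symm _ _
    rw [this]
    exact (intervalIntegral.continuous_primitive (fun _ _ => hf.intervalIntegrable) b).neg
  set Y : ℝ → ℝ := fun r => ∫ s in r..b, X s with hY
  have hYc : Continuous Y := continuous_integral_left hXc b
  have hprim {G : ℝ → ℝ} (hG : Continuous G) (r : ℝ) :
      HasDerivAt (fun r => ∫ t in a..r, G t) (G r) r := hG.integral_hasStrictDerivAt a r |>.hasDerivAt
  set n : ℝ → ℝ := fun r => -∫ t in a..r, Q t * Y t with hn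
  have hn' (r : ℝ) : HasDerivAt n (-(Q r * Y r)) r := (hprim (hQ.mul hYc) r).neg
  have hnc : Continuous n := continuous_iff_continuousAt.2 fun r => (hn' r).continuousAt
  set q : ℝ → ℝ := fun r => -(γ * X a) + ∫ t in a..r, (n t - P t * X t) with hq
  have hq' (r : ℝ) : HasDerivAt q (n r - P r * X r) r :=
    (hprim (hnc.sub (hP.mul hXc)) r).const_add _
  have hqc : Continuous q := continuous_iff_continuousAt.2 fun r => (hq' r).continuousAt
  set S : ℝ → ℝ := fun r => C * r * f r - q r with hS
  have hfi {ψ : ℝ → ℝ} (hψ : Continuous ψ) : IntervalIntegrable (fun r => ψ r * f r) volume a b :=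
    hf.intervalIntegrable.continuousOn_mul hψ.continuousOn
  have hSi : IntervalIntegrable S volume a b :=
    (hfi (continuous_const.mul continuous_id)).sub (hqc.intervalIntegrable _ _)
  have hS0 (φ : ℝ → ℝ) (hφ : Continuous φ) (h : ∫ r in a..b, ∫ t in r..b, φ t = 0) :
      ∫ r in a..b, S r * φ r = 0 := by
    have hφ1 := continuous_integral_left hφ b
    have hφ2 := continuous_integral_left hφ1 b
    have c1 : Continuous fun r => n r * ∫ t in r..b, φ t := hnc.mul hφ1
    have c2 : Continuous fun r => P r * (X r * ∫ t in r..b, φ t) := hP.mul (hXc.mul hφ1)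
    have c3 : Continuous fun r => Q r * (Y r * ∫ s in r..b, ∫ t in s..b, φ t) :=
      hQ.mul (hYc.mul hφ2)
    have h1 := integral_mul_eq_add_integral_deriv_mul hq' (hnc.sub (hP.mul hXc)) hφ a b
    have h2 := integral_mul_eq_add_integral_deriv_mul hn' (hQ.mul hYc).neg hφ1 a b
    have h3 : ∫ r in a..b, (n r - P r * X r) * ∫ t in r..b, φ t =
        (∫ r in a..b, n r * ∫ t in r..b, φ t) -
        ∫ r in a..b, P r * (X r * ∫ t in r..b, φ t) := by
      rw [← intervalIntegral.integral_sub (c1.intervalIntegrable _ _)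
        (c2.intervalIntegrable _ _)]
      exact intervalIntegral.integral_congr fun r _ => by ring
    have h4 : ∫ r in a..b, S r * φ r =
        C * (∫ r in a..b, r * f r * φ r) - ∫ r in a..b, q r * φ r := by
      rw [← intervalIntegral.integral_const_mul, ← intervalIntegral.integral_sub]
      · exact intervalIntegral.integral_congr fun r _ => by simp only [hS]; ring
      · exact (hfi (ψ := fun r => C * (r * φ r)) (by fun_prop)).congr
          fun r _ => by ring
      · exact (hqc.mul hφ).intervalIntegrable _ _
    have h5 : C * (∫ r in a..b, r * f r * φ r) + (∫ r in a..b, (P r * (X r * ∫ t in r..b, φ t) +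
        Q r * (Y r * ∫ s in r..b, ∫ t in s..b, φ t))) + γ * (X a * ∫ t in a..b, φ t) = 0 :=
      hweak φ hφ h
    rw [intervalIntegral.integral_add (c2.intervalIntegrable _ _)
      (c3.intervalIntegrable _ _)] at h5
    have h6 : ∫ r in a..b, -(Q r * Y r) * ∫ s in r..b, ∫ t in s..b, φ t =
        -∫ r in a..b, Q r * (Y r * ∫ s in r..b, ∫ t in s..b, φ t) := by
      rw [← intervalIntegral.integral_neg]
      exact intervalIntegral.integral_congr fun r _ => by ring
    have hna : n a = 0 := by simp [hn]
    have hqa : q a = -(γ * X a) := by simp [hq]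
    rw [hna, zero_mul, zero_add, h6] at h2
    rw [h3, h2, hqa] at h1
    rw [h4, h1]
    linarith
  have hlin (φ : ℝ → ℝ) (hφ : Continuous φ) :
      ∫ r in a..b, (r - a) * φ r = ∫ r in a..b, ∫ t in r..b, φ t := by
    have := integral_mul_eq_add_integral_deriv_mul (G := fun r => r - a)
      (fun r => (hasDerivAt_id r).sub_const a) continuous_const hφ a b
    simpa using this
  set D : ℝ := ∫ r in a..b, (r - a) with hD
  have hD0 : 0 < D := by
    rw [hD, intervalIntegral.integral_sub (by simp) (by simp), integral_id]
    simp
    nlinarith [mul_pos (sub_pos.2 hab) (sub_pos.2 hab)]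
  set κ : ℝ := (∫ r in a..b, S r) / D with hκ
  refine ⟨fun r => q r + κ * (r - a), fun r => n r + κ, by simp [hq, hX], fun r => ?_,
    fun r => (hn' r).add_const κ, ?_⟩
  · refine ((hq' r).add (((hasDerivAt_id r).sub_const a).const_mul κ)).congr_deriv ?_
    ring
  · have hzero := ae_eq_zero_of_integral_mul_eq_zero hab.le (F := fun r => S r - κ * (r - a))
      (hSi.sub (Continuous.intervalIntegrable (by fun_prop) _ _)) fun φ hφ => by
        set m : ℝ := (∫ r in a..b, (r - a) * φ r) / D with hm
        have h1 := hS0 (fun r => φ r - m) (hφ.sub continuous_const) (by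
          rw [← hlin (fun r => φ r - m) (hφ.sub continuous_const)]
          simp only [mul_sub]
          rw [intervalIntegral.integral_sub (Continuous.intervalIntegrable (by fun_prop) _ _)
            (Continuous.intervalIntegrable (by fun_prop) _ _),
            intervalIntegral.integral_mul_const, ← hD, hm]
          field_simp
          ring)
        simp only [mul_sub] at h1
        have hSφ : IntervalIntegrable (fun r => S r * φ r) volume a b :=
          hSi.mul_continuousOn hφ.continuousOn
        rw [intervalIntegral.integral_sub hSφ (hSi.mul_const m),
          intervalIntegral.integral_mul_const] at h1
        simp only [sub_mul, mul_assoc]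
        rw [intervalIntegral.integral_sub hSφ (Continuous.intervalIntegrable (by fun_prop) _ _),
          intervalIntegral.integral_const_mul]
        simp only [← sub_mul]
        have h2 : κ * (∫ r in a..b, (r - a) * φ r) = (∫ r in a..b, S r) * m := by
          rw [hκ, hm]
          ring
        rw [h2, h1]
    filter_upwards [hzero] with r hr
    simp only [hS, Pi.zero_apply] at hr
    linarith

end EulerLagrange

section Assembly

theorem exists_integral_mul_sq_pos {a b c : ℝ} (hc : c ∈ Ioo a b) {Q : ℝ → ℝ} (hQ : Continuous Q)
    (hQc : 0 < Q c) : ∃ φ : ℝ → ℝ, Continuous φ ∧ ∫ r in a..b, ∫ t in r..b, φ t = 0 ∧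
      0 < ∫ r in a..b, Q r * (∫ s in r..b, ∫ t in s..b, φ t) ^ 2 := by
  obtain ⟨f, hfs, -, hf, -, hfc⟩ := exists_contDiff_tsupport_subset (n := (⊤ : ℕ∞))
    (inter_mem (isOpen_Ioo.mem_nhds hc) ((isOpen_lt continuous_const hQ).mem_nhds hQc))
  have hf1 : ContDiff ℝ (⊤ : ℕ∞) (deriv f) := hf.iterate_deriv 1
  have hf2 : ContDiff ℝ (⊤ : ℕ∞) (deriv (deriv f)) := hf.iterate_deriv 2
  have hd (r : ℝ) : HasDerivAt f (deriv f r) r :=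
    (hf.differentiable (by simp) r).hasDerivAt
  have hd1 (r : ℝ) : HasDerivAt (deriv f) (deriv (deriv f) r) r :=
    (hf1.differentiable (by simp) r).hasDerivAt
  have hout {r : ℝ} (hr : r ∉ Ioo a b) : f =ᶠ[𝓝 r] 0 :=
    notMem_tsupport_iff_eventuallyEq.1 fun h => hr (hfs h).1
  have hb : f =ᶠ[𝓝 b] 0 := hout fun h => lt_irrefl _ h.2
  have hfb' : deriv f b = 0 := by
    rw [hb.deriv_eq]
    simp
  have h1 (r : ℝ) : ∫ t in r..b, deriv (deriv f) t = -deriv f r := by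
    rw [intervalIntegral.integral_eq_sub_of_hasDerivAt (fun t _ => hd1 t)
      (hf2.continuous.intervalIntegrable _ _), hfb', zero_sub]
  have h2 (r : ℝ) : ∫ s in r..b, -deriv f s = f r := by
    rw [intervalIntegral.integral_neg, intervalIntegral.integral_eq_sub_of_hasDerivAt
      (fun t _ => hd t) (hf1.continuous.intervalIntegrable _ _), hb.self_of_nhds]
    simp
  refine ⟨deriv (deriv f), hf2.continuous, ?_, ?_⟩
  · simp only [h1, h2]
    exact (hout fun h => lt_irrefl _ h.1).self_of_nhds
  · simp only [h1, h2]
    refine intervalIntegral.integral_pos (hc.1.trans hc.2)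
      (hQ.mul (hf.continuous.pow 2)).continuousOn (fun r _ => ?_)
      ⟨c, Ioo_subset_Icc_self hc, by simp [hfc, hQc]⟩
    by_cases hr : f r = 0
    · simp [hr]
    · exact mul_nonneg (hfs (subset_tsupport _ hr)).2.le (sq_nonneg _)

theorem exists_forall_le_quadratic_nonneg {K : Set ℝ} (hK : IsCompact K) {Q₀ Q₁ Q₂ : ℝ → ℝ}
    (hQ₀ : Continuous Q₀) (hQ₁ : Continuous Q₁) (hQ₂ : Continuous Q₂) (hpos : ∀ r ∈ K, 0 < Q₂ r) :
    ∃ Λ : ℝ, 0 ≤ Λ ∧ ∀ l, Λ ≤ l → ∀ r ∈ K, 0 ≤ l ^ 2 * Q₂ r + l * Q₁ r - Q₀ r := by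
  obtain ⟨Λ, hΛ⟩ := hK.exists_bound_of_continuousOn (f := fun r => (|Q₀ r| + |Q₁ r|) / Q₂ r)
    ((hQ₀.abs.add hQ₁.abs).continuousOn.div hQ₂.continuousOn fun r hr => (hpos r hr).ne')
  refine ⟨max 1 Λ, zero_le_one.trans (le_max_left _ _), fun l hl r hr => ?_⟩
  have hl1 : 1 ≤ l := (le_max_left _ _).trans hl
  have h := ((le_abs_self _).trans (hΛ r hr)).trans ((le_max_right _ _).trans hl)
  rw [div_le_iff₀ (hpos r hr)] at h
  have h1 : l * (|Q₀ r| + |Q₁ r|) ≤ l * (l * Q₂ r) := by gcongr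
  nlinarith [mul_le_mul_of_nonneg_left (neg_abs_le (Q₁ r)) (zero_le_one.trans hl1),
    le_abs_self (Q₀ r), mul_nonneg (sub_nonneg.2 hl1) (abs_nonneg (Q₀ r))]

/-- A weak solution yields a continuously differentiable solution of the first-order system. -/
theorem exists_hasDerivWithinAt_system_of_weak {a b : ℝ} (ha : 0 < a) (hab : a < b)
    {f P Q : ℝ → ℝ} (hf : Integrable f) (hf0 : ¬ f =ᵐ[volume.restrict (Ioc a b)] 0)
    (hfab : ∫ r in a..b, ∫ t in r..b, f t = 0) (hP : Continuous P) (hQ : Continuous Q)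
    {C γ : ℝ} (hC : 0 < C)
    (hweak : ∀ φ : ℝ → ℝ, Continuous φ → ∫ r in a..b, ∫ t in r..b, φ t = 0 →
      C * (∫ r in a..b, r * f r * φ r) +
        (∫ r in a..b, (P r * ((∫ t in r..b, f t) * ∫ t in r..b, φ t) +
          Q r * ((∫ s in r..b, ∫ t in s..b, f t) * ∫ s in r..b, ∫ t in s..b, φ t))) +
        γ * ((∫ t in a..b, f t) * ∫ t in a..b, φ t) = 0) :
    ∃ u x q n : ℝ → ℝ, (∀ r ∈ Icc a b, HasDerivWithinAt u (x r) (Icc a b) r) ∧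
      (∀ r ∈ Icc a b, HasDerivWithinAt x ((C * r)⁻¹ * q r) (Icc a b) r) ∧
      (∀ r ∈ Icc a b, HasDerivWithinAt q (n r + P r * x r) (Icc a b) r) ∧
      (∀ r ∈ Icc a b, HasDerivWithinAt n (-(Q r * u r)) (Icc a b) r) ∧
      u a = 0 ∧ u b = 0 ∧ x b = 0 ∧ q a = γ * x a ∧ ∃ r ∈ Icc a b, u r ≠ 0 := by
  obtain ⟨q, n, hqa, hq, hn, hfq⟩ := exists_system_of_weak hab hf hP hQ hweak
  have hqc : Continuous q := continuous_iff_continuousAt.2 fun r => (hq r).continuousAt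
  have hm (s : ℝ) : 0 < C * max s a := mul_pos hC (ha.trans_le (le_max_right _ _))
  set A : ℝ → ℝ := fun s => (C * max s a)⁻¹ * q s with hA
  have hAc : Continuous A :=
    ((continuous_const.mul (continuous_id.max continuous_const)).inv₀ fun s => (hm s).ne').mul hqc
  have hAe {r : ℝ} (hr : r ∈ Icc a b) : A r = (C * r)⁻¹ * q r := by simp [hA, max_eq_left hr.1]
  have hfA : f =ᵐ[volume.restrict (Ioc a b)] A := by
    filter_upwards [hfq, ae_restrict_mem measurableSet_Ioc] with r hr hrI
    have : 0 < C * r := mul_pos hC (ha.trans hrI.1)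
    rw [hAe (Ioc_subset_Icc_self hrI), ← hr, inv_mul_cancel_left₀ this.ne']
  have hX {r : ℝ} (hr : r ∈ Icc a b) : ∫ t in r..b, f t = ∫ t in r..b, A t := by
    rw [intervalIntegral.integral_of_le hr.2, intervalIntegral.integral_of_le hr.2]
    exact integral_congr_ae (ae_restrict_of_ae_restrict_of_subset (Ioc_subset_Ioc_left hr.1) hfA)
  have hXc : Continuous fun r => ∫ t in r..b, A t := continuous_integral_left hAc b
  have hY {r : ℝ} (hr : r ∈ Icc a b) :
      ∫ s in r..b, ∫ t in s..b, f t = ∫ s in r..b, ∫ t in s..b, A t := by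
    refine intervalIntegral.integral_congr fun s hs => ?_
    rw [uIcc_of_le hr.2] at hs
    exact hX ⟨hr.1.trans hs.1, hs.2⟩
  have haI : a ∈ Icc a b := ⟨le_rfl, hab.le⟩
  have hu' (r : ℝ) : HasDerivAt (fun r => ∫ s in r..b, ∫ t in s..b, A t) (-∫ t in r..b, A t) r :=
    hasDerivAt_integral_left hXc b r
  have hx' (r : ℝ) : HasDerivAt (fun r => -∫ t in r..b, A t) (A r) r :=
    (hasDerivAt_integral_left hAc b r).neg.congr_deriv (neg_neg _)
  refine ⟨fun r => ∫ s in r..b, ∫ t in s..b, A t, fun r => -∫ t in r..b, A t, q, n,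
    fun r _ => (hu' r).hasDerivWithinAt, fun r hr => (hAe hr) ▸ (hx' r).hasDerivWithinAt,
    fun r hr => ((hq r).congr_deriv ?_).hasDerivWithinAt,
    fun r hr => ((hn r).congr_deriv ?_).hasDerivWithinAt, ?_, by simp, by simp, ?_, ?_⟩
  · rw [hX hr]
    ring
  · rw [hY hr]
  · exact (hY haI).symm.trans hfab
  · rw [hqa, hX haI]
    ring
  · by_contra! h0
    have hz {v v' : ℝ → ℝ} (hv : ∀ r, HasDerivAt v (v' r) r) (h : ∀ r ∈ Icc a b, v r = 0) :
        ∀ r ∈ Icc a b, v' r = 0 := fun r hr =>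
      (uniqueDiffOn_Icc hab r hr).eq_deriv _ (hv r).hasDerivWithinAt
        ((hasDerivWithinAt_const r _ (0 : ℝ)).congr h (h r hr))
    have hA0 := hz hx' (hz hu' h0)
    refine hf0 (hfA.trans ?_)
    filter_upwards [ae_restrict_mem measurableSet_Ioc] with r hr
    exact hA0 r (Ioc_subset_Icc_self hr)

end Assembly

section IntegralCurve

variable {E : Type*} [NormedAddCommGroup E] [NormedSpace ℝ E] {F : E → E} {U : Set E}

/-- An integral curve of a smooth vector field is smooth. -/
theorem contDiffOn_of_hasDerivAt_vectorField (hF : ContDiffOn ℝ (⊤ : ℕ∞) F U) {S : Set ℝ}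
    (hS : IsOpen S) {y : ℝ → E} (hy : ∀ t ∈ S, HasDerivAt y (F (y t)) t)
    (hyU : MapsTo y S U) : ContDiffOn ℝ (⊤ : ℕ∞) y S := by
  rw [contDiffOn_infty]
  intro n
  induction n with
  | zero => exact contDiffOn_zero.2 fun t ht => (hy t ht).continuousAt.continuousWithinAt
  | succ n ih =>
    push_cast
    rw [contDiffOn_succ_iff_deriv_of_isOpen hS]
    refine ⟨fun t ht => (hy t ht).differentiableAt.differentiableWithinAt, by simp, ?_⟩
    exact ((contDiffOn_infty.1 hF n).comp ih hyU).congr fun t ht => (hy t ht).deriv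

/-- An integral curve of a smooth vector field on a compact interval extends to a smooth integral
curve on an open neighbourhood of the interval. -/
theorem exists_extension_of_hasDerivWithinAt_vectorField [CompleteSpace E] (hU : IsOpen U)
    (hF : ContDiffOn ℝ (⊤ : ℕ∞) F U) {a b : ℝ} (hab : a < b) {z : ℝ → E}
    (hz : ∀ t ∈ Icc a b, HasDerivWithinAt z (F (z t)) (Icc a b) t)
    (hzU : MapsTo z (Icc a b) U) :
    ∃ ε > 0, ∃ y : ℝ → E, EqOn y z (Icc a b) ∧ MapsTo y (Ioo (a - ε) (b + ε)) U ∧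
      ContDiffOn ℝ (⊤ : ℕ∞) y (Ioo (a - ε) (b + ε)) ∧
      ∀ t ∈ Ioo (a - ε) (b + ε), HasDerivAt y (F (y t)) t := by
  have loc (t₀ : ℝ) (h₀ : t₀ ∈ Icc a b) : ∃ y : ℝ → E, y t₀ = z t₀ ∧ ∃ ε > 0,
      ∀ t ∈ Ioo (t₀ - ε) (t₀ + ε), y t ∈ U ∧ HasDerivAt y (F (y t)) t := by
    have hd : ContDiffAt ℝ 1 F (z t₀) :=
      (hF.contDiffAt (hU.mem_nhds (hzU h₀))).of_le (by exact_mod_cast le_top)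
    obtain ⟨y, hy0, ε, hε, hy⟩ :=
      hd.exists_forall_mem_closedBall_exists_eq_forall_mem_Ioo_hasDerivAt₀ t₀
    have hc : ContinuousAt y t₀ := (hy t₀ ⟨by linarith, by linarith⟩).continuousAt
    obtain ⟨δ, hδ, hδU⟩ := Metric.eventually_nhds_iff_ball.1
      (hc.eventually (hU.mem_nhds (hy0 ▸ hzU h₀)))
    refine ⟨y, hy0, min ε δ, lt_min hε hδ, fun t ht => ⟨hδU t ?_, hy t ?_⟩⟩
    · rw [Real.ball_eq_Ioo]
      exact ⟨by linarith [ht.1, min_le_right ε δ], by linarith [ht.2, min_le_right ε δ]⟩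
    · exact ⟨by linarith [ht.1, min_le_left ε δ], by linarith [ht.2, min_le_left ε δ]⟩
  obtain ⟨y₁, h₁, ε₁, hε₁, hy₁⟩ := loc a ⟨le_rfl, hab.le⟩
  obtain ⟨y₂, h₂, ε₂, hε₂, hy₂⟩ := loc b ⟨hab.le, le_rfl⟩
  set y : ℝ → E := fun t => if t < a then y₁ t else if t ≤ b then z t else y₂ t with hy
  have e₁ : EqOn y y₁ (Iic a) := fun t ht => by
    rcases (show t ≤ a from ht).lt_or_eq with h | rfl
    · simp [hy, h]
    · simp [hy, hab.le, h₁]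
  have e₀ : EqOn y z (Icc a b) := fun t ht => by simp [hy, ht.1.not_gt, ht.2]
  have e₂ : EqOn y y₂ (Ici b) := fun t ht => by
    rcases (show b ≤ t from ht).lt_or_eq with h | rfl
    · simp [hy, (hab.trans h).not_gt, h.not_ge]
    · simp [hy, hab.not_gt, h₂]
  have hz' (t : ℝ) (ht : t ∈ Icc a b) : HasDerivWithinAt y (F (y t)) (Icc a b) t := by
    rw [e₀ ht]
    exact (hz t ht).congr e₀ (e₀ ht)
  have hy₁' (t : ℝ) (ht : t ∈ Iic a) (ht' : a - ε₁ < t) :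
      y t ∈ U ∧ HasDerivWithinAt y (F (y t)) (Iic a) t := by
    have := hy₁ t ⟨ht', by linarith [show t ≤ a from ht]⟩
    rw [e₁ ht]
    exact ⟨this.1, this.2.hasDerivWithinAt.congr e₁ (e₁ ht)⟩
  have hy₂' (t : ℝ) (ht : t ∈ Ici b) (ht' : t < b + ε₂) :
      y t ∈ U ∧ HasDerivWithinAt y (F (y t)) (Ici b) t := by
    have := hy₂ t ⟨by linarith [show b ≤ t from ht], ht'⟩
    rw [e₂ ht]
    exact ⟨this.1, this.2.hasDerivWithinAt.congr e₂ (e₂ ht)⟩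
  have hmain : ∀ t ∈ Ioo (a - min ε₁ ε₂) (b + min ε₁ ε₂),
      y t ∈ U ∧ HasDerivAt y (F (y t)) t := by
    intro t ht
    have g₁ : a - ε₁ < t := by linarith [ht.1, min_le_left ε₁ ε₂]
    have g₂ : t < b + ε₂ := by linarith [ht.2, min_le_right ε₁ ε₂]
    rcases lt_trichotomy t a with h | rfl | h
    · have := hy₁' t h.le g₁
      exact ⟨this.1, this.2.hasDerivAt (Iic_mem_nhds h)⟩
    · have := hy₁' t self_mem_Iic g₁
      refine ⟨this.1, (this.2.union (hz' t ⟨le_rfl, hab.le⟩)).hasDerivAt ?_⟩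
      rw [Iic_union_Icc_eq_Iic hab.le]
      exact Iic_mem_nhds hab
    · rcases lt_trichotomy t b with h' | rfl | h'
      · have ht' : t ∈ Icc a b := ⟨h.le, h'.le⟩
        exact ⟨e₀ ht' ▸ hzU ht', (hz' t ht').hasDerivAt (Icc_mem_nhds h h')⟩
      · have := hy₂' t self_mem_Ici g₂
        refine ⟨this.1, ((hz' t ⟨hab.le, le_rfl⟩).union this.2).hasDerivAt ?_⟩
        rw [Icc_union_Ici_eq_Ici hab.le]
        exact Ici_mem_nhds hab
      · have := hy₂' t h'.le g₂
        exact ⟨this.1, this.2.hasDerivAt (Ici_mem_nhds h')⟩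
  have hm : MapsTo y (Ioo (a - min ε₁ ε₂) (b + min ε₁ ε₂)) U := fun t ht => (hmain t ht).1
  exact ⟨min ε₁ ε₂, lt_min hε₁ hε₂, y, e₀, hm,
    contDiffOn_of_hasDerivAt_vectorField hF isOpen_Ioo (fun t ht => (hmain t ht).2) hm,
    fun t ht => (hmain t ht).2⟩

end IntegralCurve

section System

theorem eqOn_deriv_of_hasDerivAt {V : Set ℝ} (hV : IsOpen V) {f f' h : ℝ → ℝ}
    (hfh : EqOn f h V) (hh : ∀ r ∈ V, HasDerivAt h (f' r) r) : EqOn (deriv f) f' V :=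
  fun r hr => ((hh r hr).congr_of_eventuallyEq (hfh.eventuallyEq_of_mem (hV.mem_nhds hr))).deriv

/-- A function that is smooth near a compact interval agrees near that interval with a globally
smooth function. -/
theorem exists_contDiff_eqOn_Ioo {a b ε : ℝ} (hab : a < b) (hε : 0 < ε) {f : ℝ → ℝ}
    (hf : ContDiffOn ℝ (⊤ : ℕ∞) f (Ioo (a - ε) (b + ε))) :
    ∃ w : ℝ → ℝ, ContDiff ℝ (⊤ : ℕ∞) w ∧ EqOn w f (Ioo (a - ε / 2) (b + ε / 2)) := by
  let χ : ContDiffBump ((a + b) / 2) :=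
    ⟨(b - a) / 2 + ε / 2, (b - a) / 2 + 3 * ε / 4, by linarith, by linarith⟩
  refine ⟨fun r => χ r * f r, (contMDiff_of_tsupport fun r hr => ?_).contDiff, fun r hr => ?_⟩
  · have hr := tsupport_mul_subset_left hr
    rw [χ.tsupport_eq, Real.closedBall_eq_Icc] at hr
    have h1 : (a + b) / 2 - ((b - a) / 2 + 3 * ε / 4) ≤ r := hr.1
    have h2 : r ≤ (a + b) / 2 + ((b - a) / 2 + 3 * ε / 4) := hr.2
    exact (χ.contDiffAt.mul
      (hf.contDiffAt (Ioo_mem_nhds (by linarith) (by linarith)))).contMDiffAt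
  · have : r ∈ Metric.closedBall ((a + b) / 2) χ.rIn := by
      rw [Real.closedBall_eq_Icc]
      change r ∈ Icc ((a + b) / 2 - ((b - a) / 2 + ε / 2)) ((a + b) / 2 + ((b - a) / 2 + ε / 2))
      exact ⟨by linarith [hr.1], by linarith [hr.2]⟩
    simp [χ.one_of_mem_closedBall this]

/-- Extension of a solution of a four-dimensional linear system to a neighbourhood. -/
theorem exists_extension_linear_system {a b : ℝ} (ha : 0 < a) (hab : a < b) {A P Q : ℝ → ℝ}
    (hA : ContDiffOn ℝ (⊤ : ℕ∞) A (Ioi 0)) (hP : ContDiffOn ℝ (⊤ : ℕ∞) P (Ioi 0))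
    (hQ : ContDiffOn ℝ (⊤ : ℕ∞) Q (Ioi 0)) {u x q n : ℝ → ℝ}
    (hu : ∀ r ∈ Icc a b, HasDerivWithinAt u (x r) (Icc a b) r)
    (hx : ∀ r ∈ Icc a b, HasDerivWithinAt x (A r * q r) (Icc a b) r)
    (hq : ∀ r ∈ Icc a b, HasDerivWithinAt q (n r + P r * x r) (Icc a b) r)
    (hn : ∀ r ∈ Icc a b, HasDerivWithinAt n (-(Q r * u r)) (Icc a b) r) :
    ∃ ε > 0, ε < a ∧ ∃ u₁ x₁ q₁ n₁ : ℝ → ℝ, ContDiffOn ℝ (⊤ : ℕ∞) u₁ (Ioo (a - ε) (b + ε)) ∧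
      EqOn u₁ u (Icc a b) ∧ EqOn x₁ x (Icc a b) ∧ EqOn q₁ q (Icc a b) ∧
      ∀ r ∈ Ioo (a - ε) (b + ε), HasDerivAt u₁ (x₁ r) r ∧ HasDerivAt x₁ (A r * q₁ r) r ∧
        HasDerivAt q₁ (n₁ r + P r * x₁ r) r ∧ HasDerivAt n₁ (-(Q r * u₁ r)) r := by
  let F : ℝ × ℝ × ℝ × ℝ × ℝ → ℝ × ℝ × ℝ × ℝ × ℝ := fun z =>
    (1, z.2.2.1, A z.1 * z.2.2.2.1, z.2.2.2.2 + P z.1 * z.2.2.1, -(Q z.1 * z.2.1))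
  let U : Set (ℝ × ℝ × ℝ × ℝ × ℝ) := Prod.fst ⁻¹' Ioi 0
  have hU : IsOpen U := isOpen_Ioi.preimage continuous_fst
  have hcomp {f : ℝ → ℝ} (hf : ContDiffOn ℝ (⊤ : ℕ∞) f (Ioi 0)) :
      ContDiffOn ℝ (⊤ : ℕ∞) (fun z : ℝ × ℝ × ℝ × ℝ × ℝ => f z.1) U :=
    hf.comp contDiff_fst.contDiffOn fun _ h => h
  have hF : ContDiffOn ℝ (⊤ : ℕ∞) F U := by
    have h₁ : ContDiffOn ℝ (⊤ : ℕ∞) (fun z : ℝ × ℝ × ℝ × ℝ × ℝ => z.2.1) U := by fun_prop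
    have h₂ : ContDiffOn ℝ (⊤ : ℕ∞) (fun z : ℝ × ℝ × ℝ × ℝ × ℝ => z.2.2.1) U := by fun_prop
    have h₃ : ContDiffOn ℝ (⊤ : ℕ∞) (fun z : ℝ × ℝ × ℝ × ℝ × ℝ => z.2.2.2.1) U := by fun_prop
    have h₄ : ContDiffOn ℝ (⊤ : ℕ∞) (fun z : ℝ × ℝ × ℝ × ℝ × ℝ => z.2.2.2.2) U := by fun_prop
    exact contDiffOn_const.prodMk (h₂.prodMk (((hcomp hA).mul h₃).prodMk
      ((h₄.add ((hcomp hP).mul h₂)).prodMk ((hcomp hQ).mul h₁).neg)))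
  obtain ⟨δ, hδ, y, hyz, hyU, hyS, hy⟩ := exists_extension_of_hasDerivWithinAt_vectorField hU hF hab
    (z := fun t => (t, u t, x t, q t, n t))
    (fun t ht => (hasDerivWithinAt_id t _).prodMk ((hu t ht).prodMk ((hx t ht).prodMk
      ((hq t ht).prodMk (hn t ht)))))
    (fun t ht => ha.trans_le ht.1)
  have hfst : ∀ t ∈ Ioo (a - δ) (b + δ), (y t).1 = t := by
    have hd : ∀ t ∈ Ioo (a - δ) (b + δ), HasDerivAt (fun t => (y t).1 - t) 0 t := fun t ht => by
      refine ((hasFDerivAt_fst.comp_hasDerivAt t (hy t ht)).sub (hasDerivAt_id t)).congr_deriv ?_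
      simp [F]
    obtain ⟨c, hc⟩ := isOpen_Ioo.exists_is_const_of_deriv_eq_zero isPreconnected_Ioo
      (fun t ht => (hd t ht).differentiableAt.differentiableWithinAt) (fun t ht => (hd t ht).deriv)
    have h1 := hc a ⟨by linarith, by linarith⟩
    rw [hyz ⟨le_rfl, hab.le⟩] at h1
    intro t ht
    have h2 := hc t ht
    simp only [sub_self] at h1
    linarith
  have hsub : Ioo (a - min δ (a / 2)) (b + min δ (a / 2)) ⊆ Ioo (a - δ) (b + δ) :=
    Ioo_subset_Ioo (by linarith [min_le_left δ (a / 2)]) (by linarith [min_le_left δ (a / 2)])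
  refine ⟨min δ (a / 2), lt_min hδ (by linarith), by linarith [min_le_right δ (a / 2)],
    fun t => (y t).2.1, fun t => (y t).2.2.1, fun t => (y t).2.2.2.1, fun t => (y t).2.2.2.2,
    (hyS.snd.fst).mono hsub, fun t ht => by simp [hyz ht], fun t ht => by simp [hyz ht],
    fun t ht => by simp [hyz ht], fun r hr => ?_⟩
  have h := hy r (hsub hr)
  have h1 := hasFDerivAt_snd.comp_hasDerivAt r h
  have h2 := hasFDerivAt_snd.comp_hasDerivAt r h1
  have h3 := hasFDerivAt_snd.comp_hasDerivAt r h2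
  have hr1 := hfst r (hsub hr)
  refine ⟨?_, ?_, ?_, ?_⟩
  · exact (hasFDerivAt_fst.comp_hasDerivAt r h1).congr_deriv (by simp [F])
  · exact (hasFDerivAt_fst.comp_hasDerivAt r h2).congr_deriv (by simp [F, hr1])
  · exact (hasFDerivAt_fst.comp_hasDerivAt r h3).congr_deriv (by simp [F, hr1])
  · exact (hasFDerivAt_snd.comp_hasDerivAt r h3).congr_deriv (by simp [F, hr1])

/-- The first-order system for `u = rW` yields a solution of the fourth-order problem. -/
theorem exists_solution_of_system {R₁ R₂ μ α g : ℝ} (hR₁ : 0 < R₁) (hR₁₂ : R₁ < R₂) (hμ : 0 < μ)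
    {ρ : ℝ → ℝ} (hρ : ContDiff ℝ (⊤ : ℕ∞) ρ) (k : ℤ) {l : ℝ} (hl : 0 < l) {u x q n : ℝ → ℝ}
    (hu : ∀ r ∈ Icc R₁ R₂, HasDerivWithinAt u (x r) (Icc R₁ R₂) r)
    (hx : ∀ r ∈ Icc R₁ R₂, HasDerivWithinAt x ((l * μ * r)⁻¹ * q r) (Icc R₁ R₂) r)
    (hq : ∀ r ∈ Icc R₁ R₂, HasDerivWithinAt q
      (n r + (l ^ 2 * (r * ρ r) + l * (μ * (2 * (k : ℝ) ^ 2 + 1) * r⁻¹)) * x r) (Icc R₁ R₂) r)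
    (hn : ∀ r ∈ Icc R₁ R₂, HasDerivWithinAt n
      (-((l ^ 2 * (ρ r * (k : ℝ) ^ 2 * r⁻¹) + l * (μ * (k : ℝ) ^ 2 * ((k : ℝ) ^ 2 - 4) * r⁻¹ ^ 3) -
        (k : ℝ) ^ 2 * g * deriv ρ r * r⁻¹) * u r)) (Icc R₁ R₂) r)
    (hu₁ : u R₁ = 0) (hu₂ : u R₂ = 0) (hx₂ : x R₂ = 0) (hq₁ : q R₁ = l * (μ - α * R₁) * x R₁)
    (hne : ∃ r ∈ Icc R₁ R₂, u r ≠ 0) :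
    ∃ W : ℝ → ℝ, ContDiff ℝ (⊤ : ℕ∞) W ∧
      (∃ r ∈ Icc R₁ R₂, W r ≠ 0) ∧
      (∀ r ∈ Icc R₁ R₂,
        l * μ * ((k : ℝ) ^ 2 * Lop k W r + (4 * (k : ℝ) ^ 2 / r ^ 2) * W r -
            deriv (fun x => x * Lop k (deriv (rW W)) x) r) -
          l ^ 2 * (ρ r * (k : ℝ) ^ 2 * W r -
            deriv (fun x => x * ρ x * deriv (rW W) x) r) +
          (k : ℝ) ^ 2 * g * W r * deriv ρ r = 0) ∧
      W R₁ = 0 ∧ W R₂ = 0 ∧ deriv W R₂ = 0 ∧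
      deriv (deriv (rW W)) R₁ = (1 / R₁ - α / μ) * deriv (rW W) R₁ := by
  have hinv : ContDiffOn ℝ (⊤ : ℕ∞) (fun r : ℝ => r⁻¹) (Ioi 0) :=
    contDiffOn_id.inv fun r hr => (show (0 : ℝ) < r from hr).ne'
  have hA : ContDiffOn ℝ (⊤ : ℕ∞) (fun r : ℝ => (l * μ * r)⁻¹) (Ioi 0) :=
    (contDiffOn_const.mul contDiffOn_id).inv fun r hr =>
      (mul_pos (mul_pos hl hμ) (show (0 : ℝ) < r from hr)).ne'
  have hρ' : ContDiff ℝ (⊤ : ℕ∞) (deriv ρ) := (contDiff_infty_iff_deriv.1 hρ).2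
  have hρd (r : ℝ) : HasDerivAt ρ (deriv ρ r) r := (hρ.differentiable (by simp) r).hasDerivAt
  obtain ⟨ε, hε, hεR, u₁, x₁, q₁, n₁, hS, eu, ex, eq, hsys⟩ :=
    exists_extension_linear_system hR₁ hR₁₂ hA (P := fun r => _) (by fun_prop)
      (Q := fun r => _) (by fun_prop) hu hx hq hn
  obtain ⟨W, hW, hWeq⟩ := exists_contDiff_eqOn_Ioo hR₁₂ hε (hS.mul (hinv.mono
    fun r hr => show 0 < r by linarith [hr.1]))
  set V := Ioo (R₁ - ε / 2) (R₂ + ε / 2) with hVdef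
  have hV : IsOpen V := isOpen_Ioo
  have hIV : Icc R₁ R₂ ⊆ V := fun r hr => ⟨by linarith [hr.1], by linarith [hr.2]⟩
  have hVpos : ∀ r ∈ V, 0 < r := fun r hr => by linarith [hr.1]
  have hsys' : ∀ r ∈ V, _ := fun r hr => hsys r ⟨by linarith [hr.1], by linarith [hr.2]⟩
  have hlμ : l * μ ≠ 0 := (mul_pos hl hμ).ne'
  have hW1 : EqOn (deriv W) (fun r => x₁ r * r⁻¹ - u₁ r * r⁻¹ ^ 2) V :=
    eqOn_deriv_of_hasDerivAt hV hWeq fun r hr => by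
      have h0 := (hVpos r hr).ne'
      refine ((hsys' r hr).1.mul (hasDerivAt_inv h0)).congr_deriv ?_
      field_simp
      ring
  have hW2 : EqOn (deriv (deriv W)) (fun r => (l * μ * r)⁻¹ * q₁ r * r⁻¹ - 2 * x₁ r * r⁻¹ ^ 2 +
      2 * u₁ r * r⁻¹ ^ 3) V :=
    eqOn_deriv_of_hasDerivAt hV hW1 fun r hr => by
      have h0 := (hVpos r hr).ne'
      refine (((hsys' r hr).2.1.mul (hasDerivAt_inv h0)).sub
        ((hsys' r hr).1.mul ((hasDerivAt_inv h0).pow 2))).congr_deriv ?_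
      simp only [Pi.pow_apply, Nat.reduceSub, pow_one, Nat.cast_ofNat]
      field_simp
      ring
  have hu0 : EqOn (rW W) u₁ V := fun r hr => by
    have h0 := (hVpos r hr).ne'
    rw [rW, hWeq hr]
    field_simp
  have hu1 : EqOn (deriv (rW W)) x₁ V :=
    eqOn_deriv_of_hasDerivAt hV hu0 fun r hr => (hsys' r hr).1
  have hu2 : EqOn (deriv (deriv (rW W))) (fun r => (l * μ * r)⁻¹ * q₁ r) V :=
    eqOn_deriv_of_hasDerivAt hV hu1 fun r hr => (hsys' r hr).2.1
  have hu3 : EqOn (deriv (deriv (deriv (rW W)))) (fun r => -(l * μ) * ((l * μ * r)⁻¹ ^ 2) * q₁ r +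
      (l * μ * r)⁻¹ * (n₁ r + (l ^ 2 * (r * ρ r) + l * (μ * (2 * (k : ℝ) ^ 2 + 1) * r⁻¹)) * x₁ r))
      V :=
    eqOn_deriv_of_hasDerivAt hV hu2 fun r hr => by
      have h0 := (hVpos r hr).ne'
      refine (((((hasDerivAt_id r).const_mul (l * μ)).inv (mul_ne_zero hlμ h0)).mul
        (hsys' r hr).2.2.1)).congr_deriv ?_
      simp only [id, Pi.inv_apply]
      field_simp
  have hL : EqOn (fun x => x * Lop k (deriv (rW W)) x) (fun r => (l * μ)⁻¹ * n₁ r +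
      (k : ℝ) ^ 2 * (x₁ r * r⁻¹) + (l * μ)⁻¹ * l ^ 2 * (r * ρ r * x₁ r)) V := fun r hr => by
    have h0 := (hVpos r hr).ne'
    simp only [Lop]
    rw [hu3 hr, hu2 hr, hu1 hr]
    field_simp
    ring
  have hρx (r : ℝ) (hr : r ∈ V) : HasDerivAt (fun r => r * ρ r * x₁ r)
      ((ρ r + r * deriv ρ r) * x₁ r + r * ρ r * ((l * μ * r)⁻¹ * q₁ r)) r := by
    refine ((((hasDerivAt_id r).mul (hρd r)).mul (hsys' r hr).2.1)).congr_deriv ?_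
    simp
  have hρW := eqOn_deriv_of_hasDerivAt (f := fun x => x * ρ x * deriv (rW W) x) hV
    (fun r hr => by simp only [hu1 hr]) hρx
  have hL1 := eqOn_deriv_of_hasDerivAt hV hL fun r hr => by
    have h0 := (hVpos r hr).ne'
    exact (((hsys' r hr).2.2.2.const_mul (l * μ)⁻¹).add
      ((((hsys' r hr).2.1.mul (hasDerivAt_inv h0))).const_mul ((k : ℝ) ^ 2))).add
      ((hρx r hr).const_mul ((l * μ)⁻¹ * l ^ 2))
  have m₁ : R₁ ∈ Icc R₁ R₂ := ⟨le_rfl, hR₁₂.le⟩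
  have m₂ : R₂ ∈ Icc R₁ R₂ := ⟨hR₁₂.le, le_rfl⟩
  refine ⟨W, hW, ?_, fun r hr => ?_, ?_, ?_, ?_, ?_⟩
  · obtain ⟨r, hr, h⟩ := hne
    refine ⟨r, hr, ?_⟩
    rw [hWeq (hIV hr)]
    exact mul_ne_zero (eu hr ▸ h) (inv_ne_zero (hR₁.trans_le hr.1).ne')
  · have h0 := (hVpos r (hIV hr)).ne'
    rw [hL1 (hIV hr), hρW (hIV hr)]
    simp only [Lop]
    rw [hW2 (hIV hr), hW1 (hIV hr), hWeq (hIV hr)]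
    field_simp
    ring
  · simp [hWeq (hIV m₁), eu m₁, hu₁]
  · simp [hWeq (hIV m₂), eu m₂, hu₂]
  · simp [hW1 (hIV m₂), eu m₂, ex m₂, hu₂, hx₂]
  · rw [hu2 (hIV m₁), hu1 (hIV m₁)]
    simp only [eq m₁, ex m₁, hq₁]
    have := hR₁.ne'
    field_simp

end System

theorem statement15 (R₁ R₂ μ α g : ℝ) (hR₁ : 0 < R₁) (hR₁₂ : R₁ < R₂) (hμ : 0 < μ)
    (hg : 0 < g) (hα : 0 ≤ 1 - α * R₁ / μ) (ρ : ℝ → ℝ) (hρ : ContDiff ℝ (⊤ : ℕ∞) ρ)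
    (hρpos : ∀ r ∈ Icc R₁ R₂, 0 < ρ r)
    (hinst : ∃ rs ∈ Ioo R₁ R₂, 0 < deriv ρ rs)
    (k : ℤ) (hk : k ≠ 0) :
    ∃ lam : ℝ, 0 < lam ∧ ∃ W : ℝ → ℝ, ContDiff ℝ (⊤ : ℕ∞) W ∧
      (∃ r ∈ Icc R₁ R₂, W r ≠ 0) ∧
      (∀ r ∈ Icc R₁ R₂,
        lam * μ * ((k : ℝ) ^ 2 * Lop k W r + (4 * (k : ℝ) ^ 2 / r ^ 2) * W r -
            deriv (fun x => x * Lop k (deriv (rW W)) x) r) -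
          lam ^ 2 * (ρ r * (k : ℝ) ^ 2 * W r -
            deriv (fun x => x * ρ x * deriv (rW W) x) r) +
          (k : ℝ) ^ 2 * g * W r * deriv ρ r = 0) ∧
      W R₁ = 0 ∧ W R₂ = 0 ∧ deriv W R₂ = 0 ∧
      deriv (deriv (rW W)) R₁ = (1 / R₁ - α / μ) * deriv (rW W) R₁ := by
  obtain ⟨c, hc, hρc⟩ := hinst
  have hk2 : 0 < (k : ℝ) ^ 2 := by positivity
  have hγ : 0 ≤ μ - α * R₁ := by
    have := mul_nonneg hμ.le hα
    rwa [mul_sub, mul_one, mul_div_cancel₀ _ hμ.ne'] at this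
  have hm (r : ℝ) : 0 < max r R₁ := hR₁.trans_le (le_max_right _ _)
  have hρ' : Continuous (deriv ρ) := hρ.continuous_deriv (by simp)
  have hρc' : Continuous ρ := hρ.continuous
  set h : ℝ → ℝ := fun r => (max r R₁)⁻¹ with hh
  have hhc : Continuous h := (continuous_id.max continuous_const).inv₀ fun s => (hm s).ne'
  have hh0 (r : ℝ) : 0 < h r := inv_pos.2 (hm r)
  have hhe {r : ℝ} (hr : r ∈ Icc R₁ R₂) : h r = r⁻¹ := by simp [hh, max_eq_left hr.1]
  set P₁ : ℝ → ℝ := fun r => μ * (2 * (k : ℝ) ^ 2 + 1) * h r with hP₁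
  set P₂ : ℝ → ℝ := fun r => r * ρ r with hP₂
  set Q₀ : ℝ → ℝ := fun r => (k : ℝ) ^ 2 * g * deriv ρ r * h r with hQ₀
  set Q₁ : ℝ → ℝ := fun r => μ * (k : ℝ) ^ 2 * ((k : ℝ) ^ 2 - 4) * h r ^ 3 with hQ₁
  set Q₂ : ℝ → ℝ := fun r => ρ r * (k : ℝ) ^ 2 * h r with hQ₂
  have cP₁ : Continuous P₁ := by fun_prop
  have cP₂ : Continuous P₂ := by fun_prop
  have cQ₀ : Continuous Q₀ := by fun_prop
  have cQ₁ : Continuous Q₁ := by fun_prop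
  have cQ₂ : Continuous Q₂ := by fun_prop
  obtain ⟨Λ, hΛ0, hΛ⟩ := exists_forall_le_quadratic_nonneg (isCompact_Icc (a := R₁) (b := R₂))
    cQ₀ cQ₁ cQ₂ fun r hr => mul_pos (mul_pos (hρpos r hr) hk2) (hh0 r)
  obtain ⟨l, hl, f, hf, hf0, hfab, hweak⟩ := exists_weak_critical hR₁ hR₁₂.le cP₁ cP₂ cQ₀ cQ₁ cQ₂
    hγ hμ (fun r _ => mul_nonneg (by positivity) (hh0 r).le)
    (fun r hr => mul_nonneg (hR₁.le.trans hr.1) (hρpos r hr).le) hΛ0 hΛ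
    (exists_integral_mul_sq_pos hc cQ₀ (mul_pos (mul_pos (mul_pos hk2 hg) hρc) (hh0 c)))
  obtain ⟨u, x, q, n, hu, hx, hq, hn, hu₁, hu₂, hx₂, hq₁, hne⟩ :=
    exists_hasDerivWithinAt_system_of_weak hR₁ hR₁₂ hf hf0 hfab
      (P := fun r => l ^ 2 * P₂ r + l * P₁ r) (Q := fun r => l ^ 2 * Q₂ r + l * Q₁ r - Q₀ r)
      (by fun_prop) (by fun_prop) (mul_pos hl hμ) hweak
  refine ⟨l, hl, exists_solution_of_system (n := n) hR₁ hR₁₂ hμ hρ k hl hu hx (fun r hr => ?_)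
    (fun r hr => ?_) hu₁ hu₂ hx₂ hq₁ hne⟩
  · simpa only [hP₁, hP₂, hhe hr] using hq r hr
  · simpa only [hQ₀, hQ₁, hQ₂, hhe hr] using hn r hr

end
end
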